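/- Let (R,M,k) be a regular local ring which is a G-ring, with regular system of parameters (y,u_1,...,u_d), and let f ∈ M with f ∉ (u_1,...,u_d). If the characteristic polyhedron Δ(f;u_1,...,u_d) is empty, then there exists z ∈ R such that (z,u_1,...,u_d) is a regular system of parameters of R and Δ(f;u_1,...,u_d;z) = ∅. -/

import Mathlib

/-!
Characteristic polyhedra of singularities without completion
(V. Cossart, O. Piltant), formalized statements.
-/

noncomputable section

open IsLocalRing TensorProduct

namespace CharPolyhedra

universe u v

/-! ### Polyhedral notions -/

/-- The nonnegative orthant in `ℝ^d`. -/
def orthant (d : ℕ) : Set (Fin d → ℝ) := {x | ∀ i, 0 ≤ x i}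

/-- An `F`-subset of `ℝ_{≥0}^d`: a closed convex subset stable under translation
by the nonnegative orthant. -/
def IsFSubset {d : ℕ} (Δ : Set (Fin d → ℝ)) : Prop :=
  Δ ⊆ orthant d ∧ IsClosed Δ ∧ Convex ℝ Δ ∧ ∀ v ∈ Δ, ∀ w ∈ orthant d, v + w ∈ Δ

/-- The smallest `F`-subset containing a given set of points. -/
def smallestFSubset {d : ℕ} (X : Set (Fin d → ℝ)) : Set (Fin d → ℝ) :=
  ⋂₀ {Δ | IsFSubset Δ ∧ X ⊆ Δ}

/-- A vertex of an `F`-subset: a point cut out by a positive linear form. -/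
def IsVertex {d : ℕ} (Δ : Set (Fin d → ℝ)) (v : Fin d → ℝ) : Prop :=
  ∃ L : Fin d → ℝ, (∀ i, 0 < L i) ∧ Δ ∩ {x | ∑ i, L i * x i = 1} = {v}

/-- A rational polyhedron: an `F`-subset cut out by finitely many nonnegative
rational linear forms. -/
def IsRationalPolyhedron {d : ℕ} (Δ : Set (Fin d → ℝ)) : Prop :=
  ∃ (n : ℕ) (L : Fin n → Fin d → ℚ), (∀ j i, 0 ≤ L j i) ∧
    Δ = {x | x ∈ orthant d ∧ ∀ j, 1 ≤ ∑ i, (L j i : ℝ) * x i}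

/-- `min {L(a) : a ∈ Δ}` for a linear form with rational coefficients `L`. -/
def ellOf {d : ℕ} (L : Fin d → ℚ) (Δ : Set (Fin d → ℝ)) : ℝ :=
  sInf ((fun x => ∑ i, (L i : ℝ) * x i) '' Δ)

/-! ### Regular local rings, systems of parameters -/

/-- A family `s` of `n` elements is a regular system of parameters of the local
ring `R`: it generates the maximal ideal and `n` equals the Krull dimension. -/
def IsSysOfParams (R : Type u) [CommRing R] [IsLocalRing R] {n : ℕ} (s : Fin n → R) : Prop :=
  Ideal.span (Set.range s) = maximalIdeal R ∧ ringKrullDim R = n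

/-- `(y, u 0, ..., u (d-1))` is a regular system of parameters of `R`. -/
def IsRSP (R : Type u) [CommRing R] [IsLocalRing R] {d : ℕ} (y : R) (u : Fin d → R) : Prop :=
  IsSysOfParams R (Fin.cons y u)

/-- A regular local ring: a Noetherian local ring whose maximal ideal is
generated by a regular system of parameters. -/
def IsRegularLocalRing (R : Type u) [CommRing R] [IsLocalRing R] : Prop :=
  IsNoetherianRing R ∧ ∃ (n : ℕ) (s : Fin n → R), IsSysOfParams R s

/-- A regular ring: a Noetherian ring all of whose localizations at primes are
regular local rings. -/
def IsRegularRing (A : Type u) [CommRing A] : Prop :=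
  IsNoetherianRing A ∧ ∀ (P : Ideal A) [P.IsPrime],
    IsRegularLocalRing (Localization.AtPrime P)

/-! ### Monomial expansions and polyhedra -/

variable {R : Type u} [CommRing R]

/-- The monomial `y^b u^a`, where `ab = (a, b)`. -/
def monomial {d : ℕ} (y : R) (u : Fin d → R) (ab : (Fin d → ℕ) × ℕ) : R :=
  y ^ ab.2 * ∏ i, u i ^ ab.1 i

/-- A finite expansion `f = Σ_{(a,b)} C_{a,b} y^b u^a` with all coefficients units. -/
def IsUnitExpansion {d : ℕ} (f y : R) (u : Fin d → R)
    (c : ((Fin d → ℕ) × ℕ) →₀ R) : Prop :=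
  (∀ ab ∈ c.support, IsUnit (c ab)) ∧ f = c.sum fun ab r => r * monomial y u ab

/-- The projection `(a, b) ↦ a / (m - b)` from the point `(0, m)`. -/
def projPoint {d : ℕ} (m : ℕ) (ab : (Fin d → ℕ) × ℕ) : Fin d → ℝ :=
  fun i => (ab.1 i : ℝ) / ((m : ℝ) - (ab.2 : ℝ))

/-- The projected points attached to (the support of) an expansion. -/
def expPoints {d : ℕ} (m : ℕ) (s : Finset ((Fin d → ℕ) × ℕ)) : Set (Fin d → ℝ) :=
  {x | ∃ ab ∈ s, ab.2 < m ∧ x = projPoint m ab}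

/-- The polyhedron `Δ(f; u; y)` computed with prescribed order `m`: the smallest
`F`-subset containing the projected supports of all finite unit-coefficient
expansions of `f` in the parameters `(y, u)`. -/
def DeltaOf {d : ℕ} (f y : R) (u : Fin d → R) (m : ℕ) : Set (Fin d → ℝ) :=
  smallestFSubset (⋃ c ∈ {c | IsUnitExpansion f y u c}, expPoints m c.support)

/-- The order of the image of `f` in `R/(u_1, ..., u_d)`, i.e. the largest `n`
with `f ∈ M^n + (u_1, ..., u_d)`. -/
def ordRes {d : ℕ} [IsLocalRing R] (f : R) (u : Fin d → R) : ℕ :=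
  sSup {n : ℕ | f ∈ (maximalIdeal R) ^ n ⊔ Ideal.span (Set.range u)}

/-- Hironaka's polyhedron `Δ(f; u_1, ..., u_d; y)`. -/
def Delta {d : ℕ} [IsLocalRing R] (f y : R) (u : Fin d → R) : Set (Fin d → ℝ) :=
  DeltaOf f y u (ordRes f u)

/-! ### Completion and the characteristic polyhedron -/

/-- The `M`-adic completion `R̂` of a local ring `R`. -/
abbrev Completion (R : Type u) [CommRing R] [IsLocalRing R] : Type u :=
  AdicCompletion (maximalIdeal R) R

/-- The canonical map `R → R̂`. -/
def cmpl {R : Type u} [CommRing R] [IsLocalRing R] : R →+* Completion R :=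
  algebraMap R (Completion R)

/-- `(ŷ, u_1, ..., u_d)` is a regular system of parameters of the completion
`R̂`: it generates the maximal ideal `M·R̂` of `R̂`. -/
def IsRSPhat (R : Type u) [CommRing R] [IsLocalRing R] {d : ℕ}
    (yh : Completion R) (u : Fin d → R) : Prop :=
  Ideal.span (insert yh (Set.range fun i => cmpl (u i)))
    = (maximalIdeal R).map (cmpl (R := R))

/-- Hironaka's characteristic polyhedron `Δ(f; u_1, ..., u_d)`: the intersection
of the `Δ(f; u; ŷ)` over all regular systems of parameters `(ŷ, u_1, ..., u_d)`
of the completion `R̂`. -/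
def CharPolyhedron {d : ℕ} [IsLocalRing R] (f : R) (u : Fin d → R) : Set (Fin d → ℝ) :=
  ⋂ yh ∈ {yh : Completion R | IsRSPhat R yh u},
    DeltaOf (cmpl f) yh (fun i => cmpl (u i)) (ordRes f u)

/-! ### G-rings, excellence -/

/-- A `κ`-algebra `A` is geometrically regular if `κ' ⊗[κ] A` is a regular ring
for every finite field extension `κ'/κ`. -/
def IsGeometricallyRegularAlgebra (κ : Type u) [Field κ] (A : Type v) [CommRing A]
    [Algebra κ A] : Prop :=
  ∀ (κ' : Type u) [Field κ'] [Algebra κ κ'] [Module.Finite κ κ'],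
    IsRegularRing (κ' ⊗[κ] A)

/-- A local ring has geometrically regular formal fibers if, for every prime
`P ⊂ R`, the formal fiber `κ(P) ⊗_R R̂` is a geometrically regular
`κ(P)`-algebra. -/
def HasGeomRegularFormalFibers (R : Type u) [CommRing R] [IsLocalRing R] : Prop :=
  ∀ (P : Ideal R) [P.IsPrime],
    IsGeometricallyRegularAlgebra (ResidueField (Localization.AtPrime P))
      (ResidueField (Localization.AtPrime P) ⊗[R] Completion R)

/-- A G-ring: a Noetherian ring all of whose localizations at primes have
geometrically regular formal fibers. -/
def IsGRing (A : Type u) [CommRing A] : Prop :=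
  IsNoetherianRing A ∧ ∀ (P : Ideal A) [P.IsPrime],
    HasGeomRegularFormalFibers (Localization.AtPrime P)

/-- A saturated chain of primes: each step is a covering relation. -/
def IsSaturatedChain {A : Type u} [CommRing A] (c : LTSeries (PrimeSpectrum A)) : Prop :=
  ∀ i : Fin c.length, c.toFun i.castSucc ⋖ c.toFun i.succ

/-- A catenary ring: any two saturated chains of primes with the same endpoints
have the same length. -/
def IsCatenary (A : Type u) [CommRing A] : Prop :=
  ∀ (c₁ c₂ : LTSeries (PrimeSpectrum A)), c₁.head = c₂.head → c₁.last = c₂.last →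
    IsSaturatedChain c₁ → IsSaturatedChain c₂ → c₁.length = c₂.length

/-- Universally catenary: all polynomial rings over `A` are catenary. -/
def IsUniversallyCatenary (A : Type u) [CommRing A] : Prop :=
  ∀ n : ℕ, IsCatenary (MvPolynomial (Fin n) A)

/-- The regular locus of any domain finite over `A` is open. -/
def HasOpenRegularLocus (A : Type u) [CommRing A] : Prop :=
  ∀ (B : Type u) [CommRing B] [IsDomain B] [Algebra A B] [Module.Finite A B],
    IsOpen {P : PrimeSpectrum B | IsRegularLocalRing (Localization.AtPrime P.asIdeal)}

/-- Quasi-excellent: a G-ring with open regular loci for finite domains over it. -/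
def IsQuasiExcellent (A : Type u) [CommRing A] : Prop :=
  IsGRing A ∧ HasOpenRegularLocus A

/-- Excellent: universally catenary and quasi-excellent. -/
def IsExcellent (A : Type u) [CommRing A] : Prop :=
  IsUniversallyCatenary A ∧ IsQuasiExcellent A

/-! ### Monomial valuations and associated graded rings -/

/-- The weight `l·b + L(a)` of the monomial `y^b u^a`. -/
def weight {d : ℕ} (l : ℝ) (L : Fin d → ℝ) (ab : (Fin d → ℕ) × ℕ) : ℝ :=
  l * (ab.2 : ℝ) + ∑ i, L i * (ab.1 i : ℝ)

/-- The ideal `I_λ` generated by the monomials `y^b u^a` with `l·b + L(a) ≥ λ`. -/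
def monIdeal {d : ℕ} (y : R) (u : Fin d → R) (l : ℝ) (L : Fin d → ℝ) (lam : ℝ) :
    Ideal R :=
  Ideal.span {g | ∃ ab : (Fin d → ℕ) × ℕ, g = monomial y u ab ∧ lam ≤ weight l L ab}

/-- The monomial valuation `v(g) := max {λ : g ∈ I_λ}`. -/
def vval {d : ℕ} (y : R) (u : Fin d → R) (l : ℝ) (L : Fin d → ℝ) (g : R) : ℝ :=
  sSup {lam : ℝ | g ∈ monIdeal y u l L lam}

/-- The Rees algebra `⊕_λ I_λ` of the filtration `(I_λ)`, realized inside the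
monoid algebra `R[ℝ]`. -/
def ReesAlgebra {d : ℕ} (y : R) (u : Fin d → R) (l : ℝ) (L : Fin d → ℝ) :
    Subalgebra R (AddMonoidAlgebra R ℝ) :=
  Algebra.adjoin R {p | ∃ (lam : ℝ) (x : R), x ∈ monIdeal y u l L lam ∧
    p = AddMonoidAlgebra.single lam x}

/-- The ideal `⊕_λ I_{λ⁺}` of the Rees algebra. -/
def grIdeal {d : ℕ} (y : R) (u : Fin d → R) (l : ℝ) (L : Fin d → ℝ) :
    Ideal (ReesAlgebra y u l L) :=
  Ideal.span {p | ∃ (lam : ℝ) (x : R), (∃ lam' > lam, x ∈ monIdeal y u l L lam') ∧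
    (p : AddMonoidAlgebra R ℝ) = AddMonoidAlgebra.single lam x}

/-- The associated graded ring `gr_v(R) = ⊕_λ I_λ / I_{λ⁺}` of `R` with respect
to the monomial valuation `v`, realized as `(⊕_λ I_λ) / (⊕_λ I_{λ⁺})`. -/
abbrev GrRing {d : ℕ} (y : R) (u : Fin d → R) (l : ℝ) (L : Fin d → ℝ) : Type u :=
  ReesAlgebra y u l L ⧸ grIdeal y u l L

/-- `x ∈ gr_v(R)` is the initial form of `g ∈ R`: the class of `g` placed in
degree `v(g)`. -/
def IsInitialForm {d : ℕ} (y : R) (u : Fin d → R) (l : ℝ) (L : Fin d → ℝ) (g : R)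
    (x : GrRing y u l L) : Prop :=
  ∃ h : AddMonoidAlgebra.single (vval y u l L g) g ∈ ReesAlgebra y u l L,
    x = Ideal.Quotient.mk (grIdeal y u l L)
      ⟨AddMonoidAlgebra.single (vval y u l L g) g, h⟩


/-! ### Part 0: regular local rings are domains -/

theorem dim_le_card {A : Type u} [CommRing A] [IsLocalRing A] [IsNoetherianRing A]
    (T : Finset A) (hT : Ideal.span (T : Set A) = maximalIdeal A) :
    ringKrullDim A ≤ (T.card : WithBot ℕ∞) := by
  refine (ringKrullDim_le_spanFinrank_maximalIdeal A).trans ?_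
  have := Submodule.spanFinrank_span_le_ncard_of_finite (R := A) (M := A) T.finite_toSet
  rw [Set.ncard_coe_finset] at this
  rw [← hT]
  exact_mod_cast this

def DomThm (n : ℕ) : Prop := ∀ (A : Type u) [CommRing A] [IsLocalRing A] [IsNoetherianRing A]
    (T : Finset A), T.card ≤ n → Ideal.span (T : Set A) = maximalIdeal A →
    (n : WithBot ℕ∞) ≤ ringKrullDim A → IsDomain A

theorem prime_of_dom {k : ℕ} (hk : DomThm.{u} k) {A : Type u} [CommRing A] [IsLocalRing A]
    [IsNoetherianRing A] (S T : Finset A)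
    (hST : Ideal.span ((S : Set A) ∪ T) = maximalIdeal A) (hT : T.card ≤ k)
    (hdim : ((S.card + k : ℕ) : WithBot ℕ∞) ≤ ringKrullDim A) :
    (Ideal.span (S : Set A)).IsPrime := by
  classical
  have hSM : Ideal.span (S : Set A) ≤ maximalIdeal A := by
    rw [← hST]; exact Ideal.span_mono Set.subset_union_left
  have hne : Ideal.span (S : Set A) ≠ ⊤ := by
    intro h; rw [h] at hSM
    exact (maximalIdeal.isMaximal A).ne_top (top_le_iff.mp hSM)
  rw [← Ideal.Quotient.isDomain_iff_prime]
  haveI : Nontrivial (A ⧸ Ideal.span (S : Set A)) := Ideal.Quotient.nontrivial_iff.mpr hne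
  haveI : IsLocalRing (A ⧸ Ideal.span (S : Set A)) :=
    IsLocalRing.of_surjective' (Ideal.Quotient.mk _) Ideal.Quotient.mk_surjective
  refine hk _ (T.image (Ideal.Quotient.mk (Ideal.span (S : Set A))))
    (Finset.card_image_le.trans hT) ?_ ?_
  · rw [← IsLocalRing.map_maximalIdeal_of_surjective _
      (Ideal.Quotient.mk_surjective (I := Ideal.span (S : Set A))), ← hST, Ideal.map_span,
      Set.image_union, Ideal.span_union, Finset.coe_image]
    symm
    rw [sup_eq_right, ← Ideal.map_span, Ideal.map_quotient_self]
    exact bot_le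
  · have h1 := ringKrullDim_le_ringKrullDim_quotient_add_card S (by
      rw [IsLocalRing.ringJacobson_eq_maximalIdeal]
      exact fun x hx => hSM (Ideal.subset_span hx))
    have h2 := hdim.trans h1
    push_cast at h2
    rw [add_comm] at h2
    generalize ringKrullDim (A ⧸ Ideal.span (S : Set A)) = D at h2 ⊢
    cases D using WithBot.recBotCoe with
    | bot => exact absurd h2 (by
        simp only [WithBot.bot_add, le_bot_iff]
        intro h
        have : ((k + S.card : ℕ) : WithBot ℕ∞) = ⊥ := by push_cast; exact h
        exact absurd this (by exact WithBot.coe_ne_bot (a := ((k + S.card : ℕ) : ℕ∞))))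
    | coe D =>
      have h3 : ((k : ℕ∞) + (S.card : ℕ∞)) ≤ D + S.card := by exact_mod_cast h2
      have h4 : (k : ℕ∞) ≤ D := (ENat.add_le_add_iff_right (by simp)).mp h3
      exact_mod_cast h4

theorem isDomain_of_bot_prime {A : Type u} [CommRing A] (h : (⊥ : Ideal A).IsPrime) :
    IsDomain A := by
  have h2 := (Ideal.Quotient.isDomain_iff_prime (⊥ : Ideal A)).mpr h
  exact MulEquiv.isDomain (A ⧸ (⊥ : Ideal A)) (RingEquiv.quotientBot A).symm.toMulEquiv

theorem dom_of_nonmin {A : Type u} [CommRing A] [IsLocalRing A] [IsNoetherianRing A] (x : A)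
    (hx : x ∈ maximalIdeal A)
    (hp : (Ideal.span {x}).IsPrime) (hmin : ∀ p ∈ minimalPrimes A, x ∉ p) : IsDomain A := by
  obtain ⟨p, hpm, hple⟩ := Ideal.exists_minimalPrimes_le (I := (⊥ : Ideal A)) (J := Ideal.span {x}) bot_le
  haveI : p.IsPrime := hpm.1.1
  have : p = ⊥ := by
    apply Submodule.eq_bot_of_le_smul_of_le_jacobson_bot (Ideal.span {x}) p
      (IsNoetherian.noetherian p)
    · intro a ha
      obtain ⟨b, rfl⟩ := Ideal.mem_span_singleton'.mp (hple ha)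
      have hb : b ∈ p := (Ideal.IsPrime.mem_or_mem ‹_› ha).resolve_right (hmin p hpm)
      rw [mul_comm]
      exact Submodule.smul_mem_smul (Ideal.mem_span_singleton_self x) hb
    · rw [IsLocalRing.jacobson_eq_maximalIdeal _ bot_ne_top]
      rwa [Ideal.span_singleton_le_iff_mem]
  exact isDomain_of_bot_prime (this ▸ hpm.1.1)

theorem domThm (n : ℕ) : DomThm.{u} n := by
  classical
  induction n with
  | zero =>
    intro A _ _ _ T hT hspan _
    have : T = ∅ := by simpa using hT
    subst this
    have h : maximalIdeal A = ⊥ := by rw [← hspan]; simp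
    exact (isField_iff_maximalIdeal_eq.mpr h).isDomain
  | succ n ih =>
    intro A _ _ _ T hT hspan hdim
    have key : ∀ (x : A) (T' : Finset A), T'.card ≤ n →
        Ideal.span (insert x (T' : Set A)) = maximalIdeal A → (Ideal.span {x}).IsPrime := by
      intro x T' hc hs
      have := prime_of_dom ih {x} T' (by rw [Finset.coe_singleton, ← Set.insert_eq]; exact hs) hc
        (by rw [Finset.card_singleton, Nat.add_comm]; exact hdim)
      simpa using this
    have hcard : ∀ T' : Finset A, Ideal.span (T' : Set A) = maximalIdeal A → n + 1 ≤ T'.card := by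
      intro T' h
      have := hdim.trans (dim_le_card T' h)
      exact_mod_cast this
    have hTpos : 0 < T.card := by have := hcard T hspan; omega
    obtain ⟨x1, hx1⟩ := Finset.card_pos.mp hTpos
    obtain ⟨T', hx1', rfl⟩ : ∃ T', x1 ∉ T' ∧ insert x1 T' = T :=
      ⟨T.erase x1, Finset.notMem_erase _ _, Finset.insert_erase hx1⟩
    rw [Finset.card_insert_of_notMem hx1'] at hT
    have hT' : T'.card ≤ n := by omega
    rw [Finset.coe_insert] at hspan
    by_contra hnd
    have hall : ∀ x, Ideal.span (insert x (T' : Set A)) = maximalIdeal A →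
        ∃ p ∈ minimalPrimes A, x ∈ p := by
      intro x hx
      by_contra hcon
      push Not at hcon
      refine hnd (dom_of_nonmin x ?_ (key x T' hT' hx) hcon)
      rw [← hx]; exact Ideal.subset_span (Set.mem_insert _ _)
    rcases T'.eq_empty_or_nonempty with rfl | ⟨x2, hx2⟩
    · obtain ⟨p, hp, hxp⟩ := hall x1 hspan
      haveI := hp.1.1
      have hM : maximalIdeal A ≤ p := by
        rw [← hspan]; simpa [Ideal.span_le] using hxp
      have : p = maximalIdeal A := ((maximalIdeal.isMaximal A).eq_of_le (hp.1.1.ne_top) hM).symm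
      have h0 : (maximalIdeal A).height = 0 := by
        rw [← this]
        rw [Ideal.height_eq_zero_iff]
        exact hp
      have h1 := IsLocalRing.maximalIdeal_height_eq_ringKrullDim (R := A)
      rw [h0] at h1
      rw [← h1] at hdim
      have : (n + 1 : ℕ) ≤ 0 := by exact_mod_cast hdim
      omega
    · have hx2M : x2 ∈ maximalIdeal A := by
        rw [← hspan]; exact Ideal.subset_span (Set.mem_insert_of_mem _ (by exact_mod_cast hx2))
      have hgen : ∀ k : ℕ, Ideal.span (insert (x1 + x2 ^ (k+1)) (T' : Set A)) = maximalIdeal A := by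
        intro k
        rw [← hspan, Ideal.span_insert, Ideal.span_insert]
        have hx2' : x2 ∈ Ideal.span (T' : Set A) := Ideal.subset_span (by exact_mod_cast hx2)
        have hx2p : x2 ^ (k+1) ∈ Ideal.span (T' : Set A) := Ideal.pow_mem_of_mem _ hx2' _ (by omega)
        apply le_antisymm
        · refine sup_le ?_ le_sup_right
          rw [Ideal.span_singleton_le_iff_mem]
          exact add_mem (Ideal.mem_sup_left (Ideal.mem_span_singleton_self _)) (Ideal.mem_sup_right hx2p)
        · refine sup_le ?_ le_sup_right
          rw [Ideal.span_singleton_le_iff_mem]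
          rw [show x1 ∈ _ ↔ (x1 + x2^(k+1)) - x2^(k+1) ∈ _ by rw [add_sub_cancel_right]]
          exact sub_mem (Ideal.mem_sup_left (Ideal.mem_span_singleton_self _)) (Ideal.mem_sup_right hx2p)
      choose P hP hPx using fun k => hall _ (hgen k)
      obtain ⟨k, l, hkl, hPkl⟩ := Set.Finite.exists_lt_map_eq_of_forall_mem hP
        (minimalPrimes.finite_of_isNoetherianRing A)
      haveI : (P k).IsPrime := (hP k).1.1
      have hx2P : x2 ∈ P k := by
        have h1 : x2 ^ (k+1) * (1 - x2 ^ (l - k)) ∈ P k := by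
          have : x2 ^ (k+1) * (1 - x2 ^ (l - k)) = (x1 + x2^(k+1)) - (x1 + x2^(l+1)) := by
            have : l + 1 = (k + 1) + (l - k) := by omega
            rw [this, pow_add]; ring
          rw [this]
          exact sub_mem (hPx k) (hPkl ▸ hPx l)
        have hu : IsUnit (1 - x2 ^ (l - k)) := by
          by_contra hnu
          have h2 : 1 - x2 ^ (l-k) ∈ maximalIdeal A := hnu
          have h3 : x2 ^ (l-k) ∈ maximalIdeal A := Ideal.pow_mem_of_mem _ hx2M _ (by omega)
          have := add_mem h2 h3
          simp at this
        have := (Ideal.IsPrime.mem_or_mem ‹_› h1).resolve_right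
          (fun h => (hP k).1.1.ne_top (Ideal.eq_top_of_isUnit_mem _ h hu))
        exact Ideal.IsPrime.mem_of_pow_mem ‹_› _ this
      have hQ := key _ T' hT' (hgen k)
      have hPQ : P k = Ideal.span {x1 + x2 ^ (k+1)} := by
        have hle : Ideal.span {x1 + x2 ^ (k+1)} ≤ P k := by
          rw [Ideal.span_singleton_le_iff_mem]; exact hPx k
        exact le_antisymm ((hP k).2 ⟨hQ, bot_le⟩ hle) hle
      rw [hPQ] at hx2P
      have := hcard (insert (x1 + x2^(k+1)) (T'.erase x2)) (by
        rw [← hgen k, Finset.coe_insert]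
        apply le_antisymm
        · apply Ideal.span_mono
          apply Set.insert_subset_insert
          simp
        · rw [Ideal.span_le]
          intro z hz
          rcases hz with rfl | hz
          · exact Ideal.subset_span (Set.mem_insert _ _)
          · by_cases hzx : z = x2
            · subst hzx
              rw [Ideal.span_insert]
              exact Ideal.mem_sup_left hx2P
            · exact Ideal.subset_span (Set.mem_insert_of_mem _ (by simp [hzx]; exact_mod_cast hz)))
      have h2 := Finset.card_insert_le (x1 + x2^(k+1)) (T'.erase x2)
      rw [Finset.card_erase_of_mem hx2] at h2
      have := Finset.card_pos.mpr ⟨x2, hx2⟩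
      omega

theorem isDomain_of_regular {A : Type u} [CommRing A] [IsLocalRing A]
    (h : IsRegularLocalRing A) : IsDomain A := by
  classical
  obtain ⟨hN, n, s, hs, hd⟩ := h
  refine domThm n A (Finset.univ.image s) ?_ ?_ hd.ge
  · exact Finset.card_image_le.trans (by simp)
  · simpa using hs

/-! ### Fact P -/

section FactP
variable {A : Type u} [CommRing A] [IsLocalRing A] [IsNoetherianRing A] {n : ℕ} {s : Fin n → A}

theorem factP_prime (h : IsSysOfParams A s) (K : Finset (Fin n)) :
    (Ideal.span (s '' (K : Set (Fin n)))).IsPrime := by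
  classical
  have hc := Finset.card_image_le (s := Kᶜ) (f := s)
  have hc2 := Finset.card_image_le (s := K) (f := s)
  have h3 := Finset.card_compl K
  have h4 : K.card ≤ n := by simpa using Finset.card_le_univ K
  simp at h3
  have := prime_of_dom (domThm (n - (K.image s).card)) (K.image s) (Kᶜ.image s) (by
    rw [← h.1, Finset.coe_image, Finset.coe_image, ← Set.image_union, Finset.coe_compl,
      Set.union_compl_self, Set.image_univ]) (by omega)
      (by rw [h.2, Nat.add_sub_cancel' (by omega)])
  rwa [Finset.coe_image] at this

theorem factP_notMem (h : IsSysOfParams A s) (K : Finset (Fin n)) (j : Fin n) (hj : j ∉ K) :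
    s j ∉ Ideal.span (s '' (K : Set (Fin n))) := by
  classical
  intro hmem
  have : Ideal.span (((Finset.univ.erase j).image s : Finset A) : Set A) = maximalIdeal A := by
    rw [← h.1, Finset.coe_image]
    apply le_antisymm
    · exact Ideal.span_mono (Set.image_subset_range _ _)
    · rw [Ideal.span_le]
      rintro _ ⟨i, rfl⟩
      by_cases hij : i = j
      · subst hij
        refine Ideal.span_mono (Set.image_mono ?_) hmem
        intro k hk
        simp only [Finset.coe_erase, Finset.coe_univ, Set.mem_diff, Set.mem_univ, true_and,
          Set.mem_singleton_iff]
        rintro rfl; exact hj hk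
      · exact Ideal.subset_span ⟨i, by simp [hij], rfl⟩
  have h1 := dim_le_card _ this
  rw [h.2] at h1
  have h2 : n ≤ ((Finset.univ.erase j).image s).card := by exact_mod_cast h1
  have h3 := Finset.card_image_le (s := Finset.univ.erase j) (f := s)
  rw [Finset.card_erase_of_mem (Finset.mem_univ j)] at h3
  simp at h3
  have := j.pos
  omega

end FactP

/-! ### Powers of parameters -/

section PowP
variable {A : Type u} [CommRing A]

def powI {n : ℕ} (s : Fin n → A) (I : Finset (Fin n)) (a : Fin n → ℕ) : Ideal A :=
  Ideal.span ((fun i => s i ^ a i) '' (I : Set (Fin n)))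

theorem powI_insert {n : ℕ} (s : Fin n → A) (I : Finset (Fin n)) (a : Fin n → ℕ) (x : Fin n) :
    powI s (insert x I) a = Ideal.span {s x ^ a x} ⊔ powI s I a := by
  classical
  unfold powI
  rw [Finset.coe_insert, Set.image_insert_eq, Ideal.span_insert]

theorem powI_update {n : ℕ} (s : Fin n → A) (I : Finset (Fin n)) (a : Fin n → ℕ) (x : Fin n)
    (k : ℕ) (hx : x ∉ I) : powI s I (Function.update a x k) = powI s I a := by
  unfold powI
  congr 1
  apply Set.image_congr
  intro i hi
  have : i ≠ x := by rintro rfl; exact hx hi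
  simp [Function.update_of_ne this]

variable [IsLocalRing A] [IsNoetherianRing A] {n : ℕ} {s : Fin n → A}

theorem powI_regular_aux (h : IsSysOfParams A s) (N : ℕ) : ∀ (I : Finset (Fin n)) (a : Fin n → ℕ),
    ∑ i ∈ I, a i ≤ N → (∀ i ∈ I, 1 ≤ a i) → ∀ j ∉ I, ∀ g, s j * g ∈ powI s I a → g ∈ powI s I a := by
  classical
  induction N using Nat.strong_induction_on with
  | _ N ih =>
  intro I a hN ha j hj g hg
  by_cases hall : ∀ i ∈ I, a i = 1
  · have hI : powI s I a = Ideal.span (s '' (I : Set (Fin n))) := by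
      unfold powI
      congr 1
      apply Set.image_congr
      intro i hi
      simp [hall i hi]
    rw [hI] at hg ⊢
    exact ((factP_prime h I).mem_or_mem hg).resolve_left (factP_notMem h I j hj)
  · push Not at hall
    obtain ⟨x, hxI, hx1⟩ := hall
    have hx2 : 2 ≤ a x := by have := ha x hxI; omega
    obtain ⟨I', hxI', rfl⟩ : ∃ I', x ∉ I' ∧ insert x I' = I :=
      ⟨I.erase x, Finset.notMem_erase _ _, Finset.insert_erase hxI⟩
    have hjx : j ≠ x := by rintro rfl; simp at hj
    have hjI' : j ∉ I' := fun hh => hj (Finset.mem_insert_of_mem hh)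
    rw [Finset.sum_insert hxI'] at hN
    have hsum : ∀ k, ∑ i ∈ insert x I', Function.update a x k i = k + ∑ i ∈ I', a i := by
      intro k
      rw [Finset.sum_insert hxI', Function.update_self]
      congr 1
      apply Finset.sum_congr rfl
      intro i hi
      have : i ≠ x := by rintro rfl; exact hxI' hi
      simp [Function.update_of_ne this]
    have hone : ∀ k, 1 ≤ k → ∀ i ∈ insert x I', 1 ≤ Function.update a x k i := by
      intro k hk i hi
      by_cases hix : i = x
      · subst hix; simpa using hk
      · rw [Function.update_of_ne hix]; exact ha i hi
    have hupd : ∀ k, powI s (insert x I') (Function.update a x k)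
        = Ideal.span {s x ^ k} ⊔ powI s I' a := by
      intro k
      rw [powI_insert, Function.update_self, powI_update _ _ _ _ _ hxI']
    rw [powI_insert] at hg ⊢
    have hg1 : g ∈ Ideal.span {s x ^ 1} ⊔ powI s I' a := by
      rw [← hupd 1]
      refine ih (1 + ∑ i ∈ I', a i) (by omega) _ _ (hsum 1).le (hone 1 le_rfl) j hj g ?_
      rw [hupd 1]
      have hle : Ideal.span {s x ^ a x} ≤ Ideal.span {s x ^ 1} := by
        rw [Ideal.span_singleton_le_span_singleton]
        exact pow_dvd_pow _ (by omega)
      exact (sup_le_sup_right hle (powI s I' a)) hg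
    obtain ⟨p, hp, r, hr, rfl⟩ := Submodule.mem_sup.mp hg1
    obtain ⟨g1, rfl⟩ := Ideal.mem_span_singleton'.mp hp
    obtain ⟨q, hq, t, ht, hqt⟩ := Submodule.mem_sup.mp hg
    obtain ⟨hh, rfl⟩ := Ideal.mem_span_singleton'.mp hq
    have e1 : s x * (s j * g1 - s x ^ (a x - 1) * hh) ∈ powI s I' a := by
      have hpow : s x ^ a x = s x * s x ^ (a x - 1) := by
        rw [← pow_succ']; congr 1; omega
      have : s x * (s j * g1 - s x ^ (a x - 1) * hh) = t - s j * r := by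
        rw [hpow] at hqt
        linear_combination -hqt
      rw [this]
      exact sub_mem ht (Ideal.mul_mem_left _ _ hr)
    have e2 := ih (∑ i ∈ I', a i) (by omega) I' a le_rfl
      (fun i hi => ha i (Finset.mem_insert_of_mem hi)) x hxI' _ e1
    have e3 : s j * g1 ∈ powI s (insert x I') (Function.update a x (a x - 1)) := by
      rw [hupd]
      refine Submodule.mem_sup.mpr ⟨s x ^ (a x - 1) * hh, ?_, _, e2, by ring⟩
      exact Ideal.mul_mem_right _ _ (Ideal.mem_span_singleton_self _)
    have e4 := ih (a x - 1 + ∑ i ∈ I', a i) (by omega) _ _ (hsum _).le (hone _ (by omega)) j hj g1 e3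
    rw [hupd] at e4
    obtain ⟨q, hq, t', ht', rfl⟩ := Submodule.mem_sup.mp e4
    obtain ⟨h2, rfl⟩ := Ideal.mem_span_singleton'.mp hq
    refine Submodule.mem_sup.mpr ⟨h2 * s x ^ a x, Ideal.mul_mem_left _ _ (Ideal.mem_span_singleton_self _),
      s x * t' + r, add_mem (Ideal.mul_mem_left _ _ ht') hr, ?_⟩
    have hpow : s x ^ a x = s x * s x ^ (a x - 1) := by
      rw [← pow_succ']; congr 1; omega
    rw [hpow]; ring

theorem powI_regular (h : IsSysOfParams A s) (I : Finset (Fin n)) (a : Fin n → ℕ)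
    (ha : ∀ i ∈ I, 1 ≤ a i) (j) (hj : j ∉ I) (k : ℕ) (g) (hg : s j ^ k * g ∈ powI s I a) :
    g ∈ powI s I a := by
  induction k with
  | zero => simpa using hg
  | succ k ih =>
    apply ih
    apply powI_regular_aux h _ I a le_rfl ha j hj
    rwa [← mul_assoc, ← pow_succ']

theorem core_aux (h : IsSysOfParams A s) (N : ℕ) : ∀ e : Fin n → ℕ, ∑ i, e i ≤ N →
    ∏ i, s i ^ e i ∉ powI s Finset.univ (fun i => e i + 1) := by
  classical
  induction N using Nat.strong_induction_on with
  | _ N ih =>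
  intro e hN hmem
  by_cases hall : ∀ i, e i = 0
  · have : powI s Finset.univ (fun i => e i + 1) = maximalIdeal A := by
      rw [← h.1]; unfold powI; simp [hall]
    rw [this] at hmem
    simp [hall] at hmem
  · push Not at hall
    obtain ⟨x, hx⟩ := hall
    have hxs := Finset.notMem_erase x Finset.univ
    have hins := Finset.insert_erase (Finset.mem_univ x)
    have hlt : ∑ i, Function.update e x 0 i < ∑ i, e i := by
      apply Finset.sum_lt_sum
      · intro i _; by_cases hi : i = x
        · subst hi; simp
        · simp [Function.update_of_ne hi]
      · exact ⟨x, Finset.mem_univ _, by simp; omega⟩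
    refine ih (∑ i, Function.update e x 0 i) (by omega) (Function.update e x 0) le_rfl ?_
    have hprod : ∀ k, ∏ i, s i ^ Function.update e x k i
        = s x ^ k * ∏ i ∈ Finset.univ.erase x, s i ^ e i := by
      intro k
      rw [← Finset.mul_prod_erase _ _ (Finset.mem_univ x), Function.update_self]
      congr 1
      apply Finset.prod_congr rfl
      intro i hi
      rw [Function.update_of_ne (Finset.ne_of_mem_erase hi)]
    have hid : ∀ k, powI s Finset.univ (fun i => Function.update e x k i + 1) =
        Ideal.span {s x ^ (k+1)} ⊔ powI s (Finset.univ.erase x) (fun i => e i + 1) := by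
      intro k
      have : (fun i => Function.update e x k i + 1) = Function.update (fun i => e i + 1) x (k+1) := by
        ext i
        by_cases hi : i = x
        · subst hi; simp
        · simp [Function.update_of_ne hi]
      rw [this]
      conv_lhs => rw [← hins]
      rw [powI_insert, Function.update_self, powI_update _ _ _ _ _ hxs]
    have hm : s x ^ e x * ∏ i ∈ Finset.univ.erase x, s i ^ e i ∈
        Ideal.span {s x ^ (e x+1)} ⊔ powI s (Finset.univ.erase x) (fun i => e i + 1) := by
      rw [← hid, ← hprod, Function.update_eq_self]; exact hmem
    rw [hprod, hid]
    obtain ⟨q, hq, t, ht, hqt⟩ := Submodule.mem_sup.mp hm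
    obtain ⟨hh, rfl⟩ := Ideal.mem_span_singleton'.mp hq
    have e1 : s x ^ e x * ((∏ i ∈ Finset.univ.erase x, s i ^ e i) - s x * hh) ∈
        powI s (Finset.univ.erase x) (fun i => e i + 1) := by
      have : s x ^ e x * ((∏ i ∈ Finset.univ.erase x, s i ^ e i) - s x * hh) = t := by
        rw [mul_sub, ← hqt]; ring
      rw [this]; exact ht
    have e2 := powI_regular h _ _ (fun i _ => by omega) x hxs _ _ e1
    refine Submodule.mem_sup.mpr ⟨s x * hh, ?_, _, e2, by simp⟩
    rw [zero_add, pow_one]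
    exact Ideal.mul_mem_right _ _ (Ideal.mem_span_singleton_self _)

theorem core (h : IsSysOfParams A s) (e : Fin n → ℕ) :
    ∏ i, s i ^ e i ∉ Ideal.span (Set.range fun i => s i ^ (e i + 1)) := by
  have := core_aux h _ e le_rfl
  unfold powI at this
  rwa [Finset.coe_univ, Set.image_univ] at this

end PowP

/-! ### Monomial ideals -/

section MonI

abbrev Ex (d : ℕ) : Type := (Fin d → ℕ) × ℕ

def deg {d : ℕ} (t : Ex d) : ℕ := t.2 + ∑ i, t.1 i

theorem deg_add {d : ℕ} (t t' : Ex d) : deg (t + t') = deg t + deg t' := by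
  simp [deg, Finset.sum_add_distrib]; ring

theorem deg_mono {d : ℕ} {t t' : Ex d} (h : t ≤ t') : deg t ≤ deg t' := by
  unfold deg
  exact add_le_add h.2 (Finset.sum_le_sum fun i _ => h.1 i)

theorem add_sub_ex {d : ℕ} {t t' : Ex d} (h : t ≤ t') : t + (t' - t) = t' :=
  add_tsub_cancel_of_le h

variable {A : Type u} [CommRing A] {d : ℕ}

def mI (y : A) (u : Fin d → A) (T : Set (Ex d)) : Ideal A := Ideal.span (monomial y u '' T)

variable (y : A) (u : Fin d → A)

theorem monomial_add (t t' : Ex d) : monomial y u (t + t') = monomial y u t * monomial y u t' := by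
  simp only [monomial, Prod.snd_add, Prod.fst_add, Pi.add_apply, pow_add, Finset.prod_mul_distrib]
  ring

theorem monomial_zero : monomial y u (0 : Ex d) = 1 := by simp [monomial]

theorem monomial_y (b : ℕ) : monomial y u ((0, b) : Ex d) = y ^ b := by simp [monomial]

theorem monomial_y' : monomial y u ((0, 1) : Ex d) = y := by simp [monomial]

theorem monomial_u (i : Fin d) : monomial y u ((Pi.single i 1, 0) : Ex d) = u i := by
  simp only [monomial, pow_zero, one_mul]
  rw [Finset.prod_eq_single i]
  · simp
  · intro j _ hj; simp [Pi.single_eq_of_ne hj]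
  · simp

theorem monomial_nsmul (k : ℕ) (t : Ex d) : monomial y u (k • t) = monomial y u t ^ k := by
  induction k with
  | zero => simp [monomial_zero]
  | succ k ih => rw [succ_nsmul, monomial_add, ih, pow_succ]

variable {y u}

theorem mI_mono {T T' : Set (Ex d)} (h : T ⊆ T') : mI y u T ≤ mI y u T' :=
  Ideal.span_mono (Set.image_mono h)

theorem monomial_mem_mI {T : Set (Ex d)} {t t' : Ex d} (ht : t ∈ T) (h : t ≤ t') :
    monomial y u t' ∈ mI y u T := by
  rw [← add_sub_ex h, monomial_add]
  exact Ideal.mul_mem_right _ _ (Ideal.subset_span ⟨t, ht, rfl⟩)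

theorem mI_le_mI {T T' : Set (Ex d)} (h : ∀ t ∈ T, ∃ t' ∈ T', t' ≤ t) : mI y u T ≤ mI y u T' := by
  unfold mI
  rw [Ideal.span_le]
  rintro _ ⟨t, ht, rfl⟩
  obtain ⟨t', ht', hle⟩ := h t ht
  exact monomial_mem_mI ht' hle

theorem mI_mul {T T' T'' : Set (Ex d)} (h : ∀ t ∈ T, ∀ t' ∈ T', t + t' ∈ T'') :
    mI y u T * mI y u T' ≤ mI y u T'' := by
  unfold mI
  rw [Ideal.span_mul_span, Ideal.span_le]
  intro x hx
  obtain ⟨_, ⟨t, ht, rfl⟩, _, ⟨t', ht', rfl⟩, rfl⟩ := hx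
  beta_reduce
  rw [← monomial_add]
  exact Ideal.subset_span ⟨_, h t ht t' ht', rfl⟩

theorem mI_mul_mem {T T' T'' : Set (Ex d)} (h : ∀ t ∈ T, ∀ t' ∈ T', t + t' ∈ T'') {f g : A}
    (hf : f ∈ mI y u T) (hg : g ∈ mI y u T') : f * g ∈ mI y u T'' :=
  mI_mul h (Ideal.mul_mem_mul hf hg)

theorem mem_mI_iff {T : Set (Ex d)} {f : A} : f ∈ mI y u T ↔
    ∃ c : Ex d →₀ A, (c.support : Set (Ex d)) ⊆ T ∧ f = c.sum fun t r => r * monomial y u t := by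
  constructor
  · intro h
    obtain ⟨c, hc, rfl⟩ := (Finsupp.mem_span_image_iff_linearCombination A).mp h
    exact ⟨c, (Finsupp.mem_supported _ _).mp hc, by simp [Finsupp.linearCombination_apply]⟩
  · rintro ⟨c, hc, rfl⟩
    apply Ideal.sum_mem
    intro t ht
    exact Ideal.mul_mem_left _ _ (Ideal.subset_span ⟨t, hc ht, rfl⟩)

theorem mI_sup {T T' : Set (Ex d)} : mI y u (T ∪ T') = mI y u T ⊔ mI y u T' := by
  unfold mI
  rw [Set.image_union, Ideal.span_union]

/-- The core independence property. -/
def CoreProp (y : A) (u : Fin d → A) : Prop :=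
  ∀ e : Ex d, monomial y u e ∉ mI y u {t | ¬ t ≤ e}

theorem lemmaB (hc : CoreProp y u) {f : A} {e : Ex d} {C : A} (hC : IsUnit C) {T : Set (Ex d)}
    (hf : f ∈ mI y u T) (hr : f - C * monomial y u e ∈ mI y u {t | ¬ t ≤ e}) : ∃ t ∈ T, t ≤ e := by
  by_contra hcon
  push Not at hcon
  have h1 : f ∈ mI y u {t | ¬ t ≤ e} := mI_mono hcon hf
  have h2 := sub_mem h1 hr
  rw [sub_sub_cancel] at h2
  refine hc e ?_
  obtain ⟨C, rfl⟩ := hC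
  have := Ideal.mul_mem_left _ (↑C⁻¹ : A) h2
  rwa [← mul_assoc, Units.inv_mul, one_mul] at this

/-- every point of the support of a unit expansion is above a member of T. -/
theorem lemmaB_exp (hc : CoreProp y u) {f : A} {c : Ex d →₀ A} (hcu : IsUnitExpansion f y u c)
    {T : Set (Ex d)} (hf : f ∈ mI y u T) {t : Ex d} (ht : t ∈ c.support) : ∃ t' ∈ T, t' ≤ t := by
  classical
  obtain ⟨e, hmin⟩ : ∃ e, e ≤ t ∧ Minimal (· ∈ c.support) e := by
    obtain ⟨e, he1, he2⟩ := Set.Finite.exists_le_minimal c.support.finite_toSet ht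
    exact ⟨e, he1, he2⟩
  obtain ⟨hle, hmin⟩ := hmin
  obtain ⟨t', ht', h1⟩ := lemmaB hc (hcu.1 e hmin.1) hf (e := e) (by
    rw [hcu.2, Finsupp.sum, ← Finset.add_sum_erase _ _ hmin.1, add_sub_cancel_left]
    apply Ideal.sum_mem
    intro s hs
    refine Ideal.mul_mem_left _ _ (Ideal.subset_span ⟨s, ?_, rfl⟩)
    intro hse
    exact (Finset.ne_of_mem_erase hs) (le_antisymm hse (hmin.2 (Finset.mem_of_mem_erase hs) hse)))
  exact ⟨t', ht', h1.trans hle⟩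

theorem CoreProp.of_expansion {m : ℕ} (hc : CoreProp y u) {f : A} (hf : f ∈ Ideal.span {y ^ m})
    {c : Ex d →₀ A} (hcu : IsUnitExpansion f y u c) {t : Ex d} (ht : t ∈ c.support) : m ≤ t.2 := by
  obtain ⟨t', rfl, h⟩ := lemmaB_exp hc hcu (T := {(0, m)}) (by
    unfold mI; rw [Set.image_singleton, monomial_y]; exact hf) ht
  exact h.2

variable [IsLocalRing A]

/-- `(y,u)` generates the maximal ideal. -/
def IsPar (y : A) (u : Fin d → A) : Prop := Ideal.span (insert y (Set.range u)) = maximalIdeal A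

theorem deg_one_iff (t : Ex d) : deg t = 1 ↔ t = (0, 1) ∨ ∃ i, t = (Pi.single i 1, 0) := by
  constructor
  · intro h
    unfold deg at h
    by_cases hb : t.2 = 0
    · right
      rw [hb, zero_add] at h
      obtain ⟨i, -, hi⟩ : ∃ i ∈ Finset.univ, t.1 i ≠ 0 := by
        apply Finset.exists_ne_zero_of_sum_ne_zero; omega
      rw [← Finset.add_sum_erase _ _ (Finset.mem_univ i)] at h
      have h0 : ∑ x ∈ Finset.univ.erase i, t.1 x = 0 := by omega
      refine ⟨i, Prod.ext ?_ hb⟩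
      ext j
      by_cases hj : j = i
      · subst hj; simp; omega
      · rw [Finset.sum_eq_zero_iff] at h0
        rw [h0 j (by simp [hj])]; simp [Pi.single_eq_of_ne hj]
    · left
      have h0 : ∑ i, t.1 i = 0 := by omega
      rw [Finset.sum_eq_zero_iff] at h0
      refine Prod.ext ?_ (by simp; omega)
      ext j; simpa using h0 j
  · rintro (rfl | ⟨i, rfl⟩) <;> simp [deg]

theorem mI_deg_one (h : IsPar y u) : mI y u {t | deg t = 1} = maximalIdeal A := by
  rw [← h]
  unfold mI
  congr 1
  ext x
  simp only [Set.mem_image, Set.mem_setOf_eq, deg_one_iff, Set.mem_insert_iff, Set.mem_range]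
  constructor
  · rintro ⟨t, rfl | ⟨i, rfl⟩, rfl⟩
    · left; exact monomial_y' _ _
    · right; exact ⟨i, (monomial_u _ _ _).symm⟩
  · rintro (rfl | ⟨i, rfl⟩)
    · exact ⟨_, Or.inl rfl, monomial_y' _ _⟩
    · exact ⟨_, Or.inr ⟨i, rfl⟩, monomial_u _ _ _⟩

theorem pow_le_mI (h : IsPar y u) (N : ℕ) : maximalIdeal A ^ N ≤ mI y u {t | deg t = N} := by
  induction N with
  | zero =>
    have : (1 : A) ∈ mI y u {t | deg t = 0} :=
      monomial_zero y u ▸ Ideal.subset_span ⟨0, by simp [deg], rfl⟩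
    rw [(Ideal.eq_top_iff_one _).mpr this]; exact le_top
  | succ N ih =>
    rw [pow_succ]
    refine (Ideal.mul_mono ih (mI_deg_one h).ge).trans (mI_mul ?_)
    intro t ht t' ht'
    simp only [Set.mem_setOf_eq] at *
    rw [deg_add, ht, ht']

theorem monomial_mem_pow (h : IsPar y u) (t : Ex d) : monomial y u t ∈ maximalIdeal A ^ deg t := by
  have hy : y ∈ maximalIdeal A := h ▸ Ideal.subset_span (Set.mem_insert _ _)
  have hu : ∀ i, u i ∈ maximalIdeal A := fun i =>
    h ▸ Ideal.subset_span (Set.mem_insert_of_mem _ ⟨i, rfl⟩)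
  unfold monomial deg
  rw [pow_add, ← Finset.prod_pow_eq_pow_sum]
  exact Ideal.mul_mem_mul (Ideal.pow_mem_pow hy _) (Ideal.prod_mem_prod fun i _ => Ideal.pow_mem_pow (hu i) _)

theorem mI_le_pow (h : IsPar y u) (N : ℕ) : mI y u {t | N ≤ deg t} ≤ maximalIdeal A ^ N := by
  unfold mI; rw [Ideal.span_le]
  rintro _ ⟨t, ht, rfl⟩
  exact Ideal.pow_le_pow_right ht (monomial_mem_pow h t)

theorem nonunit_mul_mem (h : IsPar y u) {c : A} (hc : ¬ IsUnit c) (t : Ex d) :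
    c * monomial y u t ∈ mI y u {t' | t < t'} := by
  have hc' : c ∈ mI y u {t | deg t = 1} := by rw [mI_deg_one h]; exact hc
  refine mI_mul_mem (T' := {t}) ?_ hc' (Ideal.subset_span ⟨t, rfl, rfl⟩)
  rintro s hs t rfl
  have hs : deg s = 1 := hs
  refine lt_of_le_of_ne (b := s + t) (le_add_self : t ≤ s + t) ?_
  intro heq
  have := congrArg deg heq
  rw [deg_add] at this; omega

/-- split lemma -/
theorem split (h : IsPar y u) {f : A} {W P : Set (Ex d)} (hf : f ∈ mI y u W)
    (hP : ∀ t ∈ P, ∀ t', t < t' → t' ∈ W \ P) :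
    f ∈ mI y u (W \ P) ∨ ∃ t ∈ P ∩ W, ∃ c, IsUnit c ∧ f - c * monomial y u t ∈ mI y u (W \ {t}) := by
  classical
  obtain ⟨c, hcW, rfl⟩ := mem_mI_iff.mp hf
  by_cases hex : ∃ t ∈ c.support, t ∈ P ∧ IsUnit (c t)
  · right
    obtain ⟨t, ht, htP, hu⟩ := hex
    refine ⟨t, ⟨htP, hcW ht⟩, c t, hu, ?_⟩
    rw [Finsupp.sum, ← Finset.add_sum_erase _ _ ht, add_sub_cancel_left]
    apply Ideal.sum_mem
    intro s hs
    exact Ideal.mul_mem_left _ _ (Ideal.subset_span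
      ⟨s, ⟨hcW (Finset.mem_of_mem_erase hs), Finset.ne_of_mem_erase hs⟩, rfl⟩)
  · left
    push Not at hex
    apply Ideal.sum_mem
    intro t ht
    by_cases htP : t ∈ P
    · exact mI_mono (fun t' ht' => hP t htP t' ht') (nonunit_mul_mem h (hex t ht htP) t)
    · exact Ideal.mul_mem_left _ _ (Ideal.subset_span ⟨t, ⟨hcW ht, htP⟩, rfl⟩)

end MonI

/-! ### Complete local rings: unit expansions -/

section Lead
variable {S : Type u} [CommRing S] [IsLocalRing S] {d : ℕ}

theorem lead_exists {y : S} {u : Fin d → S} (h : IsPar y u) (N : ℕ) (g : S)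
    (hg : g ∈ maximalIdeal S ^ N) : ∃ c : Ex d →₀ S, (∀ t ∈ c.support, deg t = N ∧ IsUnit (c t)) ∧
      g - (c.sum fun t r => r * monomial y u t) ∈ maximalIdeal S ^ (N+1) := by
  classical
  obtain ⟨c, hc, rfl⟩ := mem_mI_iff.mp (pow_le_mI h N hg)
  refine ⟨c.filter (fun t => IsUnit (c t)), ?_, ?_⟩
  · intro t ht
    rw [Finsupp.support_filter, Finset.mem_filter] at ht
    refine ⟨hc ht.1, ?_⟩
    rw [Finsupp.filter_apply_pos (fun t => IsUnit (c t)) _ ht.2]; exact ht.2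
  · have : (c.sum fun t r => r * monomial y u t) =
      ((c.filter (fun t => IsUnit (c t))).sum fun t r => r * monomial y u t) +
      ((c.filter (fun t => ¬ IsUnit (c t))).sum fun t r => r * monomial y u t) := by
      rw [← Finsupp.sum_add_index' (by simp) (by intros; ring), Finsupp.filter_add_filter_not]
    rw [this, add_sub_cancel_left]
    apply Ideal.sum_mem
    intro t ht
    rw [Finsupp.support_filter, Finset.mem_filter] at ht
    beta_reduce
    rw [Finsupp.filter_apply_pos (fun t => ¬ IsUnit (c t)) _ ht.2, pow_succ']
    have hN : deg t = N := hc ht.1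
    rw [← hN]
    exact Ideal.mul_mem_mul ht.2 (monomial_mem_pow h t)

end Lead

section Cpl
variable {S : Type u} [CommRing S] [IsLocalRing S] [IsAdicComplete (maximalIdeal S) S] {d : ℕ}

theorem haus_S (x : S) (h : ∀ n, x ∈ maximalIdeal S ^ n) : x = 0 := by
  refine IsHausdorff.haus' (I := maximalIdeal S) x (fun n => ?_)
  rw [SModEq.zero]
  simpa using h n

theorem prec_S (f : ℕ → S) (h : ∀ n, f (n+1) - f n ∈ maximalIdeal S ^ n) :
    ∃ L, ∀ n, L - f n ∈ maximalIdeal S ^ n := by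
  have hmn : ∀ m k, f (m + k) - f m ∈ maximalIdeal S ^ m := by
    intro m k
    induction k with
    | zero => simp
    | succ k ih =>
      have : f (m + (k+1)) - f m = (f (m + k + 1) - f (m + k)) + (f (m+k) - f m) := by
        rw [← add_assoc]; ring
      rw [this]
      exact add_mem (Ideal.pow_le_pow_right (by omega) (h (m+k))) ih
  obtain ⟨L, hL⟩ := IsPrecomplete.prec' (I := maximalIdeal S) f (by
    intro m n hmn'
    obtain ⟨k, rfl⟩ := Nat.exists_eq_add_of_le hmn'
    rw [SModEq.sub_mem]
    have := neg_mem (hmn m k)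
    rw [neg_sub] at this
    simpa using this)
  refine ⟨L, fun n => ?_⟩
  have := hL n
  rw [SModEq.sub_mem] at this
  have := neg_mem this
  rw [neg_sub] at this
  simpa using this

theorem unit_expansion {y : S} {u : Fin d → S} (h : IsPar y u) (f : S) :
    ∃ c, IsUnitExpansion f y u c := by
  classical
  choose! lead hlead1 hlead2 using fun N g hg => lead_exists h N g hg
  let F : ℕ → S := fun n => Nat.rec f
    (fun N g => g - ((lead N g).sum fun t r => r * monomial y u t)) n
  have hF0 : F 0 = f := rfl
  have hFs : ∀ N, F (N+1) = F N - ((lead N (F N)).sum fun t r => r * monomial y u t) := fun _ => rfl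
  have hFm : ∀ N, F N ∈ maximalIdeal S ^ N := by
    intro N
    induction N with
    | zero => simp
    | succ N ih => rw [hFs]; exact hlead2 N _ ih
  let c : ℕ → Ex d →₀ S := fun N => lead N (F N)
  have hcdeg : ∀ N, ∀ t ∈ (c N).support, deg t = N := fun N t ht => (hlead1 N _ (hFm N) t ht).1
  have hcu : ∀ N, ∀ t ∈ (c N).support, IsUnit (c N t) := fun N t ht => (hlead1 N _ (hFm N) t ht).2
  have hsum : ∀ n, ∑ N ∈ Finset.range n, ((c N).sum fun t r => r * monomial y u t) = f - F n := by
    intro n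
    induction n with
    | zero => simp [hF0]
    | succ n ih => rw [Finset.sum_range_succ, ih, hFs]; ring
  let T : Set (Ex d) := {t | t ∈ (c (deg t)).support}
  have hTfin : {t | Minimal (· ∈ T) t}.Finite := by
    apply WellQuasiOrderedLE.finite_of_isAntichain
    exact setOfPred_minimal_antichain _
  have hτ : ∀ t : Ex d, ∃ τ, t ∈ T → (τ ≤ t ∧ Minimal (· ∈ T) τ) := by
    intro t
    by_cases ht : t ∈ T
    · obtain ⟨τ, h1, h2⟩ := exists_minimal_le_of_wellFoundedLT (· ∈ T) t ht
      exact ⟨τ, fun _ => ⟨h1, h2⟩⟩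
    · exact ⟨0, fun h => absurd h ht⟩
  choose τ hτ using hτ
  have hτmin : ∀ t, Minimal (· ∈ T) t → τ t = t := by
    intro t ht
    obtain ⟨h1, h2⟩ := hτ t ht.1
    exact le_antisymm h1 (ht.2 h2.1 h1)
  have hcT : ∀ N, ∀ t ∈ (c N).support, t ∈ T := by
    intro N t ht
    have hd := hcdeg N t ht
    change t ∈ (c (deg t)).support
    rw [hd]; exact ht
  let M : Finset (Ex d) := hTfin.toFinset
  have hM : ∀ t, t ∈ M ↔ Minimal (· ∈ T) t := fun t => by simp [M]
  let B : ℕ := M.sup deg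
  have hB : ∀ t ∈ M, deg t ≤ B := fun t ht => Finset.le_sup ht
  let g : Ex d → ℕ → S := fun s n => ∑ N ∈ Finset.range n,
    ∑ t ∈ (c N).support with τ t = s, c N t * monomial y u (t - s)
  have hterm : ∀ s ∈ M, ∀ N, ∀ t ∈ (c N).support, τ t = s →
      c N t * monomial y u (t - s) ∈ maximalIdeal S ^ (N - B) := by
    intro s hs N t ht hts
    refine Ideal.mul_mem_left _ _ (Ideal.pow_le_pow_right ?_ (monomial_mem_pow h (t - s)))
    have hle : s ≤ t := hts ▸ (hτ t (hcT N t ht)).1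
    have h1 := congrArg deg (add_sub_ex hle)
    rw [deg_add, hcdeg N t ht] at h1
    have := hB s hs
    omega
  have hlim : ∀ s ∈ M, ∃ L, ∀ n, L - g s (n + B) ∈ maximalIdeal S ^ n := by
    intro s hs
    apply prec_S (fun n => g s (n + B))
    intro n
    have : g s (n + 1 + B) - g s (n + B) =
        ∑ t ∈ (c (n + B)).support with τ t = s, c (n + B) t * monomial y u (t - s) := by
      simp only [g]
      rw [show n + 1 + B = (n + B) + 1 by ring, Finset.sum_range_succ, add_sub_cancel_left]
    rw [this]
    apply Ideal.sum_mem
    intro t ht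
    rw [Finset.mem_filter] at ht
    have := hterm s hs (n + B) t ht.1 ht.2
    rwa [Nat.add_sub_cancel] at this
  choose! G hG using hlim
  have hGu : ∀ s ∈ M, IsUnit (G s) := by
    intro s hs
    have hmin := (hM s).mp hs
    have hsT : s ∈ (c (deg s)).support := hmin.1
    have h1 := hG s hs 1
    have h2 : g s (1 + B) - c (deg s) s ∈ maximalIdeal S := by
      have hr : deg s ∈ Finset.range (1 + B) := by
        rw [Finset.mem_range]; have := hB s hs; omega
      have hs2 : s ∈ (c (deg s)).support.filter (fun t => τ t = s) := by
        rw [Finset.mem_filter]; exact ⟨hsT, hτmin s hmin⟩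
      have hne : ∀ N, ∀ t ∈ (c N).support, τ t = s → t ≠ s →
          c N t * monomial y u (t - s) ∈ maximalIdeal S := by
        intro N t ht hts hne
        have hle : s ≤ t := hts ▸ (hτ t (hcT N t ht)).1
        refine Ideal.mul_mem_left _ _ ?_
        have h3 := monomial_mem_pow h (t - s)
        have h4 : 1 ≤ deg (t - s) := by
          by_contra hlt
          have h0 : deg (t - s) = 0 := by omega
          have : t - s = 0 := by
            unfold deg at h0
            have ha : (t - s).2 = 0 := by omega
            have hb : ∑ i, (t - s).1 i = 0 := by omega
            rw [Finset.sum_eq_zero_iff] at hb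
            exact Prod.ext (funext fun i => hb i (Finset.mem_univ i)) ha
          apply hne
          rw [← add_sub_ex hle, this, add_zero]
        have := Ideal.pow_le_pow_right h4 h3
        rwa [pow_one] at this
      simp only [g]
      rw [← Finset.add_sum_erase _ _ hr, ← Finset.add_sum_erase _ _ hs2, tsub_self, monomial_zero,
        mul_one, add_assoc, add_sub_cancel_left]
      refine add_mem (Ideal.sum_mem _ fun t ht => ?_) (Ideal.sum_mem _ fun N hN =>
        Ideal.sum_mem _ fun t ht => ?_)
      · rw [Finset.mem_erase, Finset.mem_filter] at ht
        exact hne _ t ht.2.1 ht.2.2 ht.1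
      · rw [Finset.mem_filter] at ht
        refine hne _ t ht.1 ht.2 ?_
        rintro rfl
        exact (Finset.ne_of_mem_erase hN) (hcdeg N _ ht.1).symm
    rw [pow_one] at h1
    have h3 := add_mem h1 h2
    rw [sub_add_sub_cancel] at h3
    by_contra hnu
    have h4 := sub_mem (show G s ∈ maximalIdeal S from hnu) h3
    rw [sub_sub_cancel] at h4
    exact h4 (hcu _ s hsT)
  refine ⟨Finsupp.onFinset M (fun s => if s ∈ M then G s else 0)
    (fun s hs => by by_contra hcon; simp [hcon] at hs), ?_, ?_⟩
  · intro s hs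
    have hsM : s ∈ M := Finsupp.support_onFinset_subset hs
    simpa [hsM] using hGu s hsM
  · rw [Finsupp.onFinset_sum _ (by intro; ring)]
    rw [← sub_eq_zero]
    apply haus_S
    intro n
    have h1 : ∑ s ∈ M, g s (n + B) * monomial y u s = f - F (n + B) := by
      rw [← hsum]
      simp only [g, Finset.sum_mul]
      rw [Finset.sum_comm]
      apply Finset.sum_congr rfl
      intro N _
      rw [Finsupp.sum, ← Finset.sum_fiberwise_of_maps_to (s := (c N).support) (t := M) (g := τ)]
      · apply Finset.sum_congr rfl
        intro s hs
        apply Finset.sum_congr rfl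
        intro t ht
        rw [Finset.mem_filter] at ht
        have hle : s ≤ t := ht.2 ▸ (hτ t (hcT N t ht.1)).1
        rw [mul_assoc, ← monomial_add, tsub_add_cancel_of_le hle]
      · intro t ht
        rw [hM]; exact (hτ t (hcT N t ht)).2
    have h2 : f - ∑ s ∈ M, (if s ∈ M then G s else 0) * monomial y u s =
        F (n + B) - ∑ s ∈ M, (G s - g s (n+B)) * monomial y u s := by
      simp only [sub_mul, Finset.sum_sub_distrib, h1]
      rw [Finset.sum_congr rfl (fun s hs => by rw [if_pos hs])]
      ring
    rw [h2]
    refine sub_mem (Ideal.pow_le_pow_right (by omega) (hFm (n+B))) (Ideal.sum_mem _ fun s hs => ?_)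
    exact Ideal.mul_mem_right _ _ (hG s hs n)

end Cpl

/-! ### Weights -/

section Weights
variable {d : ℕ}

def lam (L : Fin d → ℝ) (a : Fin d → ℕ) : ℝ := ∑ i, L i * (a i : ℝ)

theorem exists_Lam (d : ℕ) : ∃ L : Fin d → ℝ, (∀ i, 0 < L i) ∧
    ∀ q : Fin d → ℤ, ∑ i, L i * (q i : ℝ) = 0 → q = 0 := by
  let b := Module.Basis.ofVectorSpace ℚ ℝ
  haveI : Infinite (Module.Basis.ofVectorSpaceIndex ℚ ℝ) := by
    rw [Cardinal.infinite_iff, b.mk_eq_rank'', Real.rank_rat_real]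
    exact Cardinal.aleph0_le_continuum
  let φ : Fin d ↪ Module.Basis.ofVectorSpaceIndex ℚ ℝ :=
    Fin.valEmbedding.trans (Infinite.natEmbedding _)
  have hli : LinearIndependent ℚ (fun i => b (φ i)) := b.linearIndependent.comp φ φ.injective
  rw [Fintype.linearIndependent_iff] at hli
  refine ⟨fun i => |b (φ i)|, fun i => abs_pos.mpr (b.ne_zero _), ?_⟩
  intro q hq
  have := hli (fun i => ((SignType.sign (b (φ i)) : ℤ) * q i : ℚ)) (by
    rw [← hq]
    apply Finset.sum_congr rfl
    intro i _
    beta_reduce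
    rcases lt_trichotomy (b (φ i)) 0 with h | h | h
    · rw [sign_neg h, abs_of_neg h]; simp [Rat.smul_def]; ring
    · exact absurd h (b.ne_zero _)
    · rw [sign_pos h, abs_of_pos h]; simp [Rat.smul_def]; ring)
  ext i
  have h1 := this i
  rcases lt_trichotomy (b (φ i)) 0 with h | h | h
  · rw [sign_neg h] at h1; simpa using h1
  · exact absurd h (b.ne_zero _)
  · rw [sign_pos h] at h1; simpa using h1

variable (L : Fin d → ℝ)

theorem lam_add (a b : Fin d → ℕ) : lam L (a + b) = lam L a + lam L b := by
  simp [lam, mul_add, Finset.sum_add_distrib]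

theorem lam_nsmul (k : ℕ) (a : Fin d → ℕ) : lam L (k • a) = k * lam L a := by
  simp only [lam, Finset.mul_sum]
  apply Finset.sum_congr rfl
  intro i _
  simp; ring

theorem weight_eq (l : ℝ) (t : Ex d) : weight l L t = l * t.2 + lam L t.1 := rfl

theorem weight_add (l : ℝ) (t t' : Ex d) : weight l L (t + t') = weight l L t + weight l L t' := by
  simp only [weight_eq, Prod.fst_add, Prod.snd_add, lam_add]; push_cast; ring

variable {L}

theorem lam_nonneg (hL : ∀ i, 0 < L i) (a : Fin d → ℕ) : 0 ≤ lam L a :=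
  Finset.sum_nonneg fun i _ => mul_nonneg (hL i).le (by positivity)

theorem lam_pos (hL : ∀ i, 0 < L i) {a : Fin d → ℕ} (ha : a ≠ 0) : 0 < lam L a := by
  obtain ⟨i, hi⟩ := Function.ne_iff.mp ha
  refine Finset.sum_pos' (fun i _ => mul_nonneg (hL i).le (by positivity)) ⟨i, Finset.mem_univ _, ?_⟩
  have : 0 < a i := Nat.pos_of_ne_zero hi
  exact mul_pos (hL i) (by exact_mod_cast this)

theorem lam_mono (hL : ∀ i, 0 < L i) {a b : Fin d → ℕ} (h : a ≤ b) : lam L a ≤ lam L b :=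
  Finset.sum_le_sum fun i _ => mul_le_mul_of_nonneg_left (by exact_mod_cast h i) (hL i).le

theorem weight_mono (hL : ∀ i, 0 < L i) {l : ℝ} (hl : 0 < l) {t t' : Ex d} (h : t ≤ t') :
    weight l L t ≤ weight l L t' := by
  rw [weight_eq, weight_eq]
  exact add_le_add (mul_le_mul_of_nonneg_left (by exact_mod_cast h.2) hl.le) (lam_mono hL h.1)

theorem weight_strict (hL : ∀ i, 0 < L i) {l : ℝ} (hl : 0 < l) {t t' : Ex d} (h : t < t') :
    weight l L t < weight l L t' := by
  have h1 := add_sub_ex h.le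
  rw [← h1, weight_add]
  have hne : t' - t ≠ 0 := by
    intro h0; rw [h0, add_zero] at h1; exact h.ne h1
  have : 0 < weight l L (t' - t) := by
    rw [weight_eq]
    by_cases h2 : (t' - t).2 = 0
    · have h3 : (t' - t).1 ≠ 0 := fun h3 => hne (Prod.ext h3 h2)
      have := lam_pos hL h3
      rw [h2]; simpa using this
    · have h4 : 0 < (t' - t).2 := Nat.pos_of_ne_zero h2
      have := lam_nonneg hL (t' - t).1
      have h5 : 0 < l * ((t' - t).2 : ℝ) := mul_pos hl (by exact_mod_cast h4)
      linarith
  linarith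

theorem finite_lam_le (hL : ∀ i, 0 < L i) (C : ℝ) : {a : Fin d → ℕ | lam L a ≤ C}.Finite := by
  refine (Set.finite_Iic (fun i => ⌈C / L i⌉₊)).subset ?_
  intro a ha i
  have h1 : L i * a i ≤ lam L a :=
    Finset.single_le_sum (f := fun i => L i * (a i : ℝ))
      (fun i _ => mul_nonneg (hL i).le (by positivity)) (Finset.mem_univ i)
  have h2 : (a i : ℝ) ≤ C / L i := by
    rw [le_div_iff₀ (hL i)]
    have : lam L a ≤ C := ha
    linarith
  exact_mod_cast h2.trans (Nat.le_ceil _)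

variable (L)
def wset (m : ℕ) (l : ℝ) : Set (Ex d) := {t | l * m ≤ weight l L t}

theorem mem_wset {m : ℕ} {l : ℝ} {t : Ex d} :
    t ∈ wset L m l ↔ l * ((m : ℝ) - t.2) ≤ lam L t.1 := by
  simp only [wset, Set.mem_setOf_eq, weight_eq]
  constructor <;> intro h <;> linarith

variable {L}
theorem mem_wset_of_le (hL : ∀ i, 0 < L i) {m : ℕ} {l : ℝ} (hl : 0 < l) {t : Ex d} (h : m ≤ t.2) :
    t ∈ wset L m l := by
  rw [mem_wset]
  have h1 : (m : ℝ) ≤ t.2 := by exact_mod_cast h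
  have := lam_nonneg hL t.1
  nlinarith

theorem wset_anti (hL : ∀ i, 0 < L i) {m : ℕ} {l l' : ℝ} (hl : 0 < l') (h : l' ≤ l) :
    wset L m l ⊆ wset L m l' := by
  intro t ht
  by_cases hb : m ≤ t.2
  · exact mem_wset_of_le hL hl hb
  · rw [mem_wset] at *
    have h1 : (t.2 : ℝ) < m := by exact_mod_cast (not_le.mp hb)
    nlinarith

theorem wset_gap (hL : ∀ i, 0 < L i) (m : ℕ) {l : ℝ} (hl : 0 < l) :
    ∃ l' < l, 0 < l' ∧ ∀ l'', l' ≤ l'' → l'' ≤ l → wset L m l'' ⊆ wset L m l := by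
  classical
  have hfin : ((fun p : (Fin d → ℕ) × ℕ => lam L p.1 / p.2) ''
      ({a : Fin d → ℕ | lam L a ≤ l * m} ×ˢ Set.Iic m)).Finite :=
    ((finite_lam_le hL _).prod (Set.finite_Iic m)).image _
  set V := hfin.toFinset.filter (· < l) with hV
  obtain ⟨l0, hl0, hl0', hmax⟩ : ∃ l0 < l, 0 ≤ l0 ∧ ∀ v ∈ V, v ≤ l0 := by
    by_cases hne : (insert 0 V).Nonempty
    · refine ⟨(insert 0 V).max' hne, ?_, ?_, ?_⟩
      · rw [Finset.max'_lt_iff]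
        intro v hv
        rcases Finset.mem_insert.mp hv with rfl | hv
        · exact hl
        · exact (Finset.mem_filter.mp hv).2
      · exact Finset.le_max' _ _ (Finset.mem_insert_self _ _)
      · intro v hv; exact Finset.le_max' _ _ (Finset.mem_insert_of_mem hv)
    · exact absurd (Finset.insert_nonempty _ _) hne
  refine ⟨(l0 + l)/2, by linarith, by linarith, ?_⟩
  intro l'' h1 h2 t ht
  by_cases hb : m ≤ t.2
  · exact mem_wset_of_le hL hl hb
  · rw [mem_wset] at *
    by_contra hcon
    push Not at hcon
    have hb' := not_le.mp hb
    have hmb : (0 : ℝ) < (m : ℝ) - t.2 := by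
      have : (t.2 : ℝ) < m := by exact_mod_cast hb'
      linarith
    have hcast : ((m - t.2 : ℕ) : ℝ) = (m : ℝ) - t.2 := by rw [Nat.cast_sub hb'.le]
    have hv : lam L t.1 / ((m : ℝ) - t.2) ∈ V := by
      rw [hV, Finset.mem_filter, Set.Finite.mem_toFinset]
      refine ⟨⟨(t.1, m - t.2), ⟨?_, ?_⟩, ?_⟩, ?_⟩
      · simp only [Set.mem_setOf_eq]
        refine hcon.le.trans (mul_le_mul_of_nonneg_left ?_ hl.le)
        have : (0 : ℝ) ≤ t.2 := by positivity
        linarith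
      · simp
      · simp only [hcast]
      · rw [div_lt_iff₀ hmb]; exact hcon
    have h3 := hmax _ hv
    rw [div_le_iff₀ hmb] at h3
    nlinarith

theorem max_attained (hL : ∀ i, 0 < L i) (m : ℕ) (Q : ℝ → Prop)
    (hQ : ∀ l l', 0 < l → 0 < l' → wset L m l ⊆ wset L m l' → Q l → Q l')
    {l0 C : ℝ} (hl0 : 0 < l0) (hQ0 : Q l0) (hC : ∀ l, 0 < l → Q l → l ≤ C) :
    ∃ l, 0 < l ∧ Q l ∧ ∀ l', l < l' → ¬ Q l' := by
  let G : Set ℝ := {l | 0 < l ∧ Q l}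
  have hne : G.Nonempty := ⟨l0, hl0, hQ0⟩
  have hbdd : BddAbove G := ⟨C, fun l hl => hC l hl.1 hl.2⟩
  have hpos : 0 < sSup G := lt_of_lt_of_le hl0 (le_csSup hbdd ⟨hl0, hQ0⟩)
  obtain ⟨l', hl', hl'0, hgap⟩ := wset_gap hL m hpos
  obtain ⟨l1, hl1, hl1'⟩ := exists_lt_of_lt_csSup hne hl'
  refine ⟨sSup G, hpos, hQ l1 _ hl1.1 hpos (hgap l1 hl1'.le (le_csSup hbdd hl1)) hl1.2, ?_⟩
  intro l2 h2 hq
  exact absurd (le_csSup hbdd ⟨hpos.trans h2, hq⟩) (not_le.mpr h2)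

variable {A : Type u} [CommRing A] {y : A} {u : Fin d → A}

/-- C1 -/
theorem wset_improve (hL : ∀ i, 0 < L i) {m : ℕ} {l : ℝ} (hl : 0 < l) {f : A}
    (hf : f ∈ mI y u {t | m ≤ t.2 ∨ l * m < weight l L t}) :
    ∃ l', l < l' ∧ f ∈ mI y u (wset L m l') := by
  classical
  obtain ⟨c, hc, rfl⟩ := mem_mI_iff.mp hf
  have key : ∀ F : Finset (Ex d), (F : Set (Ex d)) ⊆ {t | m ≤ t.2 ∨ l * m < weight l L t} →
      ∃ l', l < l' ∧ (F : Set (Ex d)) ⊆ wset L m l' := by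
    intro F
    induction F using Finset.induction_on with
    | empty => intro _; exact ⟨l + 1, by linarith, by simp⟩
    | insert t F _ ih =>
      intro h
      rw [Finset.coe_insert, Set.insert_subset_iff] at h
      obtain ⟨l1, h1, h2⟩ := ih h.2
      obtain ⟨l2, h3, h4⟩ : ∃ l2, l < l2 ∧ t ∈ wset L m l2 := by
        by_cases hb : m ≤ t.2
        · exact ⟨l + 1, by linarith, mem_wset_of_le hL (by linarith) hb⟩
        · have hw := h.1.resolve_left hb
          have hb' := not_le.mp hb
          have hmb : (0 : ℝ) < (m : ℝ) - t.2 := by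
            have : (t.2 : ℝ) < m := by exact_mod_cast hb'
            linarith
          refine ⟨lam L t.1 / ((m : ℝ) - t.2), ?_, ?_⟩
          · rw [lt_div_iff₀ hmb]
            rw [weight_eq] at hw; linarith
          · rw [mem_wset, div_mul_cancel₀ _ hmb.ne']
      refine ⟨min l1 l2, lt_min h1 h3, ?_⟩
      have hmin : 0 < min l1 l2 := hl.trans (lt_min h1 h3)
      rw [Finset.coe_insert, Set.insert_subset_iff]
      exact ⟨wset_anti hL hmin (min_le_right _ _) h4,
        fun s hs => wset_anti hL hmin (min_le_left _ _) (h2 hs)⟩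
  obtain ⟨l', h1, h2⟩ := key c.support hc
  exact ⟨l', h1, mem_mI_iff.mpr ⟨c, h2, rfl⟩⟩

/-- exact term lemma -/
theorem exact_term [IsLocalRing A] (hL : ∀ i, 0 < L i) (hy : IsPar y u) {m : ℕ} {l : ℝ} (hl : 0 < l) {f : A}
    (hf : f ∈ mI y u (wset L m l)) (hmax : ∀ l', l < l' → f ∉ mI y u (wset L m l')) :
    ∃ t : Ex d, t.2 < m ∧ weight l L t = l * m ∧ ∃ c, IsUnit c ∧
      f - c * monomial y u t ∈ mI y u (wset L m l \ {t}) := by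
  rcases split hy hf (P := {t | t.2 < m ∧ weight l L t = l * m}) (by
    rintro t ⟨_, ht⟩ t' htt'
    have := weight_strict hL hl htt'
    refine ⟨?_, ?_⟩
    · simp only [wset, Set.mem_setOf_eq]; linarith
    · rintro ⟨_, h2⟩; linarith) with h | ⟨t, ⟨⟨h1, h2⟩, _⟩, c, hc, hr⟩
  · obtain ⟨l', h1, h2⟩ := wset_improve (y := y) (u := u) hL hl (m := m) (f := f) (mI_mono (by
      rintro t ⟨ht1, ht2⟩
      by_cases hb : m ≤ t.2
      · exact Or.inl hb
      · right
        refine lt_of_le_of_ne ht1 ?_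
        intro heq
        exact ht2 ⟨not_le.mp hb, heq.symm⟩) h)
    exact absurd h2 (hmax l' h1)
  · exact ⟨t, h1, h2, c, hc, hr⟩

/-- any element of weight `≥`, other than `t` of exact weight, is not below `t`. -/
theorem not_le_of_wset (hL : ∀ i, 0 < L i) {m : ℕ} {l : ℝ} (hl : 0 < l) {t s : Ex d}
    (ht : weight l L t = l * m) (hs : s ∈ wset L m l \ {t}) : ¬ s ≤ t := by
  intro hle
  have := weight_strict hL hl (lt_of_le_of_ne hle hs.2)
  have h1 : l * m ≤ weight l L s := hs.1
  linarith

end Weights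

/-! ### Comparison of parameters -/

section Cmp
variable {d : ℕ} {A : Type u} [CommRing A] {y y' : A} {u : Fin d → A} {L : Fin d → ℝ}

theorem mI_le_span_u : mI y u {t | t.1 ≠ 0} ≤ Ideal.span (Set.range u) := by
  classical
  unfold mI
  rw [Ideal.span_le]
  rintro _ ⟨t, ht, rfl⟩
  obtain ⟨i, hi⟩ := Function.ne_iff.mp ht
  have h1 : ((Pi.single i 1, 0) : Ex d) ≤ t := by
    refine ⟨?_, Nat.zero_le _⟩
    intro j
    by_cases hj : j = i
    · subst hj; simpa using Nat.one_le_iff_ne_zero.mpr hi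
    · simp [Pi.single_eq_of_ne hj]
  rw [← add_sub_ex h1, monomial_add, monomial_u]
  exact Ideal.mul_mem_right _ _ (Ideal.subset_span ⟨i, rfl⟩)

theorem span_u_le_mI : Ideal.span (Set.range u) ≤ mI y u {t | t.1 ≠ 0} := by
  rw [Ideal.span_le]
  rintro _ ⟨i, rfl⟩
  rw [← monomial_u y u i]
  refine Ideal.subset_span ⟨_, ?_, rfl⟩
  intro h
  have := congrFun h i
  simp at this

theorem mI_congr_zero {T : Set (Ex d)} (hT : ∀ t ∈ T, t.2 = 0) : mI y u T = mI y' u T := by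
  unfold mI
  congr 1
  apply Set.image_congr
  intro t ht
  simp [monomial, hT t ht]

theorem mI_le_span_y : mI y u {t | 1 ≤ t.2} ≤ Ideal.span {y} := by
  unfold mI
  rw [Ideal.span_le]
  rintro _ ⟨t, ht, rfl⟩
  have h1 : ((0, 1) : Ex d) ≤ t := ⟨fun j => Nat.zero_le _, ht⟩
  rw [← add_sub_ex h1, monomial_add, monomial_y']
  exact Ideal.mul_mem_right _ _ (Ideal.mem_span_singleton_self _)

theorem mI_le_span_ym (m : ℕ) : mI y u {t | m ≤ t.2} ≤ Ideal.span {y ^ m} := by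
  unfold mI
  rw [Ideal.span_le]
  rintro _ ⟨t, ht, rfl⟩
  have h1 : ((0, m) : Ex d) ≤ t := ⟨fun j => Nat.zero_le _, ht⟩
  rw [← add_sub_ex h1, monomial_add, monomial_y]
  exact Ideal.mul_mem_right _ _ (Ideal.mem_span_singleton_self _)

theorem change_mono {l : ℝ} (h : y' ∈ mI y u {t | l ≤ weight l L t}) (t : Ex d) :
    monomial y' u t ∈ mI y u {s | weight l L t ≤ weight l L s} := by
  have hpow : ∀ b : ℕ, y' ^ b ∈ mI y u {s | l * b ≤ weight l L s} := by
    intro b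
    induction b with
    | zero =>
      rw [pow_zero, ← monomial_zero y u]
      exact Ideal.subset_span ⟨0, by simp [weight], rfl⟩
    | succ b ih =>
      rw [pow_succ]
      refine mI_mul_mem ?_ ih h
      intro s hs s' hs'
      simp only [Set.mem_setOf_eq] at *
      rw [weight_add]; push_cast; linarith
  have h2 : monomial y' u t = y' ^ t.2 * monomial y u (t.1, 0) := by simp [monomial]
  rw [h2]
  refine mI_mul_mem (T' := {(t.1, 0)}) ?_ (hpow t.2) (Ideal.subset_span ⟨_, rfl, rfl⟩)
  rintro s hs _ rfl
  simp only [Set.mem_setOf_eq] at *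
  rw [weight_add, weight_eq L l t, weight_eq L l (t.1, 0)]
  simpa using hs

theorem change_le {l w : ℝ} (h : y' ∈ mI y u {t | l ≤ weight l L t}) :
    mI y' u {t | w ≤ weight l L t} ≤ mI y u {t | w ≤ weight l L t} := by
  conv_lhs => unfold mI
  rw [Ideal.span_le]
  rintro _ ⟨t, ht, rfl⟩
  have ht : w ≤ _ := ht
  exact mI_mono (fun s (hs : _ ≤ _) => ht.trans hs) (change_mono h t)

theorem change_lt {l w : ℝ} (h : y' ∈ mI y u {t | l ≤ weight l L t}) :
    mI y' u {t | w < weight l L t} ≤ mI y u {t | w < weight l L t} := by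
  conv_lhs => unfold mI
  rw [Ideal.span_le]
  rintro _ ⟨t, ht, rfl⟩
  have ht : w < _ := ht
  exact mI_mono (fun s (hs : _ ≤ _) => lt_of_lt_of_le ht hs) (change_mono h t)

theorem y_mem_fil {l : ℝ} : y ∈ mI y u {t | l ≤ weight l L t} := by
  have : monomial y u (0, 1) ∈ mI y u {t | l ≤ weight l L t} :=
    Ideal.subset_span ⟨(0, 1), by simp [weight], rfl⟩
  rwa [monomial_y'] at this

theorem zero_fil {l l' : ℝ} (h : l ≤ l') :
    mI y u {t | t.2 = 0 ∧ l' ≤ lam L t.1} ≤ mI y u {t | l ≤ weight l L t} := by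
  apply mI_mono
  rintro t ⟨h1, h2⟩
  simp only [Set.mem_setOf_eq, weight_eq, h1]
  simp; linarith

theorem pow_sub_pow_mem {l : ℝ} {z k : A} (hz : z ∈ mI y u {t | l ≤ weight l L t}) 
    (hk : k ∈ mI y u {t | l < weight l L t}) (m : ℕ) :
    (z + k) ^ m - z ^ m ∈ mI y u {t | l * m < weight l L t} ∧
      z ^ m ∈ mI y u {t | l * m ≤ weight l L t} := by
  induction m with
  | zero =>
    refine ⟨by simp, ?_⟩
    rw [pow_zero, ← monomial_zero y u]
    exact Ideal.subset_span ⟨0, by simp [weight], rfl⟩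
  | succ m ih =>
    obtain ⟨ih1, ih2⟩ := ih
    refine ⟨?_, ?_⟩
    · have : (z + k) ^ (m+1) - z ^ (m+1) = ((z + k)^m - z^m) * (z + k) + z ^ m * k := by ring
      rw [this]
      have hss : {t : Ex d | l < weight l L t} ⊆ {t | l ≤ weight l L t} := by
        intro t ht
        simp only [Set.mem_setOf_eq] at *
        linarith
      have hle : k ∈ mI y u {t | l ≤ weight l L t} := mI_mono hss hk
      have hzk : z + k ∈ mI y u {t | l ≤ weight l L t} := Ideal.add_mem _ hz hle
      refine Ideal.add_mem _ (mI_mul_mem (T := {t | l * m < weight l L t})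
        (T' := {t | l ≤ weight l L t}) ?_ ih1 hzk)
        (mI_mul_mem (T := {t | l * m ≤ weight l L t}) (T' := {t | l < weight l L t}) ?_ ih2 hk)
      · intro s hs s' hs'
        simp only [Set.mem_setOf_eq] at *
        rw [weight_add]; push_cast; linarith
      · intro s hs s' hs'
        simp only [Set.mem_setOf_eq] at *
        rw [weight_add]; push_cast; linarith
    · rw [pow_succ]
      refine mI_mul_mem ?_ ih2 hz
      intro s hs s' hs'
      simp only [Set.mem_setOf_eq] at *
      rw [weight_add]; push_cast; linarith

variable [IsLocalRing A]

theorem par_unit (hy' : IsPar y' u) (hc : CoreProp y' u) (hy : IsPar y u) {e : A}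
    (h : y' - e * y ∈ Ideal.span (Set.range u)) : IsUnit e := by
  by_contra hnu
  have he : e ∈ maximalIdeal A := hnu
  have hym : y ∈ maximalIdeal A := hy ▸ Ideal.subset_span (Set.mem_insert _ _)
  have h2 : e * y ∈ maximalIdeal A ^ 2 := by rw [pow_two]; exact Ideal.mul_mem_mul he hym
  have h3 := pow_le_mI hy' 2 h2
  have h4 : y' ∈ mI y' u {t | ¬ t ≤ (0, 1)} := by
    have h7 := span_u_le_mI (y := y') h
    suffices hs : (y' - e * y) + e * y ∈ mI y' u {t | ¬ t ≤ (0, 1)} from by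
      have h9 : (y' - e * y) + e * y = y' := by ring
      rwa [h9] at hs
    refine Ideal.add_mem _ (mI_mono (T := {t | t.1 ≠ 0}) ?_ h7)
      (mI_mono (T := {t | deg t = 2}) ?_ h3)
    · intro t ht hle
      apply ht
      have := hle.1
      exact le_antisymm this (fun i => Nat.zero_le _)
    · intro t ht hle
      have h5 := deg_mono hle
      have h6 : deg t = 2 := ht
      simp [deg] at h5 h6
      omega
  have := hc (0, 1)
  rw [monomial_y'] at this
  exact this h4

theorem par_of (hy : IsPar y u) {e : A} (he : IsUnit e)
    (h : y' - e * y ∈ Ideal.span (Set.range u)) : IsPar y' u := by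
  unfold IsPar at *
  rw [← hy, Ideal.span_insert, Ideal.span_insert]
  apply le_antisymm
  · refine sup_le ?_ le_sup_right
    rw [Ideal.span_singleton_le_iff_mem, ← sub_add_cancel y' (e * y)]
    exact add_mem (Ideal.mem_sup_right h) (Ideal.mem_sup_left (Ideal.mul_mem_left _ _
      (Ideal.mem_span_singleton_self _)))
  · refine sup_le ?_ le_sup_right
    rw [Ideal.span_singleton_le_iff_mem]
    obtain ⟨e, rfl⟩ := he
    have : y = ↑e⁻¹ * y' - ↑e⁻¹ * (y' - ↑e * y) := by
      rw [mul_sub, ← mul_assoc, Units.inv_mul]; ring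
    rw [this]
    exact sub_mem (Ideal.mem_sup_left (Ideal.mul_mem_left _ _ (Ideal.mem_span_singleton_self _)))
      (Ideal.mem_sup_right (Ideal.mul_mem_left _ _ h))

theorem lam_set_le_u (hL : ∀ i, 0 < L i) {l : ℝ} (hl : 0 < l) {T : Set (Ex d)}
    (hT : ∀ t ∈ T, l ≤ lam L t.1) : mI y u T ≤ Ideal.span (Set.range u) := by
  refine (mI_mono ?_).trans (mI_le_span_u (y := y))
  intro t ht h0
  have := hT t ht
  rw [h0] at this
  simp [lam] at this
  linarith

theorem decomp_y {g : A} {T : Set (Ex d)} (hg : g ∈ mI y u ({t | 1 ≤ t.2} ∪ T)) :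
    ∃ e, g - e * y ∈ mI y u T := by
  rw [mI_sup] at hg
  obtain ⟨p, hp, q, hq, rfl⟩ := Submodule.mem_sup.mp hg
  obtain ⟨e, rfl⟩ := Ideal.mem_span_singleton'.mp (mI_le_span_y hp)
  exact ⟨e, by simpa using hq⟩

theorem exists_mu0 (hL : ∀ i, 0 < L i) : ∃ l : ℝ, 0 < l ∧ ∀ i, l ≤ L i := by
  rcases isEmpty_or_nonempty (Fin d) with h | h
  · exact ⟨1, one_pos, fun i => h.elim i⟩
  · obtain ⟨i, hi⟩ := Finite.exists_min L
    exact ⟨L i, hL i, hi⟩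

theorem cmp_raw (hL : ∀ i, 0 < L i)
    (hind : ∀ q : Fin d → ℤ, ∑ i, L i * (q i : ℝ) = 0 → q = 0)
    (hy' : IsPar y' u) (hc : CoreProp y' u) (hy : IsPar y u) (l1 : ℝ) :
    (∃ l, l1 < l ∧ 0 < l ∧ ∃ e, IsUnit e ∧ y' - e * y ∈ mI y u {t | t.2 = 0 ∧ l ≤ lam L t.1}) ∨
    (∃ w c e, IsUnit c ∧ IsUnit e ∧ 0 < lam L w ∧ lam L w ≤ l1 ∧
      y' - c * monomial y u (w, 0) - e * y ∈ mI y u {t | t.2 = 0 ∧ lam L w < lam L t.1}) := by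
  have hsub : ∀ l : ℝ, wset L 1 l ⊆ {t : Ex d | 1 ≤ t.2} ∪ {t | t.2 = 0 ∧ l ≤ lam L t.1} := by
    intro l t ht
    rw [mem_wset] at ht
    by_cases hb : 1 ≤ t.2
    · exact Or.inl hb
    · right
      have hb0 : t.2 = 0 := by omega
      rw [hb0] at ht
      refine ⟨hb0, ?_⟩
      simpa using ht
  by_cases hex : ∃ l, l1 < l ∧ 0 < l ∧ y' ∈ mI y u (wset L 1 l)
  · left
    obtain ⟨l, h1, h2, h3⟩ := hex
    obtain ⟨e, he⟩ := decomp_y (mI_mono (hsub l) h3)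
    exact ⟨l, h1, h2, e, par_unit hy' hc hy (lam_set_le_u hL h2 (fun t ht => ht.2) he), he⟩
  · right
    push Not at hex
    obtain ⟨l0, hl0, hl0'⟩ := exists_mu0 hL
    have hQ0 : y' ∈ mI y u (wset L 1 l0) := by
      have : y' ∈ maximalIdeal A := hy' ▸ Ideal.subset_span (Set.mem_insert _ _)
      rw [← mI_deg_one hy] at this
      refine mI_mono ?_ this
      intro t ht
      rcases (deg_one_iff t).mp ht with rfl | ⟨i, rfl⟩
      · exact mem_wset_of_le hL hl0 le_rfl
      · rw [mem_wset]
        have : lam L (Pi.single i 1) = L i := by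
          unfold lam
          rw [Finset.sum_eq_single i]
          · simp
          · intro j _ hj; simp [Pi.single_eq_of_ne hj]
          · simp
        simp [this, hl0' i]
    obtain ⟨l, hl, hQ, hmax⟩ := max_attained hL 1 (fun l => y' ∈ mI y u (wset L 1 l))
      (fun l l' _ _ hs h => mI_mono hs h) hl0 hQ0 (C := l1) (by
        intro l hl hq
        by_contra hcon
        exact hex l (not_le.mp hcon) hl hq)
    obtain ⟨t, ht1, ht2, c, hcu, hr⟩ := exact_term hL hy hl hQ hmax
    obtain ⟨w, b⟩ := t
    have hb : b = 0 := by simpa using ht1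
    subst hb
    have hlw : lam L w = l := by
      rw [weight_eq] at ht2
      simpa using ht2
    have hs2 : wset L 1 l \ {(w, 0)} ⊆
        {t : Ex d | 1 ≤ t.2} ∪ {t | t.2 = 0 ∧ lam L w < lam L t.1} := by
      rintro t ⟨ht, hne⟩
      rcases hsub l ht with h | ⟨h, h'⟩
      · exact Or.inl h
      · right
        refine ⟨h, lt_of_le_of_ne (hlw ▸ h') ?_⟩
        intro heq
        apply hne
        refine Prod.ext ?_ h
        have := hind (fun i => (w i : ℤ) - t.1 i) (by
          have : lam L w - lam L t.1 = 0 := by linarith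
          rw [← this]
          simp only [lam, ← Finset.sum_sub_distrib]
          apply Finset.sum_congr rfl
          intro i _
          push_cast; ring)
        ext i
        have := congrFun this i
        simp at this
        change t.1 i = w i
        omega
    obtain ⟨e, he⟩ := decomp_y (mI_mono hs2 hr)
    refine ⟨w, c, e, hcu, ?_, hlw ▸ hl, ?_, he⟩
    · apply par_unit hy' hc hy
      have h1 := lam_set_le_u hL hl (fun t ht => by
        have : lam L w < lam L t.1 := ht.2
        linarith) he
      have h2 : monomial y u (w, 0) ∈ Ideal.span (Set.range u) :=
        lam_set_le_u (y := y) hL hl (T := {(w, 0)}) (fun t ht => by rw [ht, hlw])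
          (Ideal.subset_span ⟨_, rfl, rfl⟩)
      have := add_mem h1 (Ideal.mul_mem_left _ c h2)
      convert this using 1; ring
    · rw [hlw]
      by_contra hcon
      exact hex l (not_le.mp hcon) hl hQ

end Cmp

section Cmp2
variable {d : ℕ} {A : Type u} [CommRing A] [IsLocalRing A] {y y' : A} {u : Fin d → A}
  {L : Fin d → ℝ}

theorem zero_fil_lt {l : ℝ} :
    mI y u {t | t.2 = 0 ∧ l < lam L t.1} ≤ mI y u {t | l < weight l L t} := by
  apply mI_mono
  rintro t ⟨h1, h2⟩
  simp only [Set.mem_setOf_eq, weight_eq, h1]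
  simp; linarith

theorem lt_fil_le {l : ℝ} :
    mI y u {t | l < weight l L t} ≤ mI y u {t | l ≤ weight l L t} := by
  apply mI_mono
  intro t h1
  simp only [Set.mem_setOf_eq] at *
  linarith

theorem cmp_i (hL : ∀ i, 0 < L i) {l0 l : ℝ} (hl0 : 0 < l0) (hl : 0 < l) {m : ℕ} {f e : A}
    (hf : f ∈ mI y u (wset L m l0)) (he : IsUnit e)
    (h : y' - e * y ∈ mI y u {t | t.2 = 0 ∧ l ≤ lam L t.1}) :
    f ∈ mI y' u (wset L m (min l0 l)) := by
  have hmin : 0 < min l0 l := lt_min hl0 hl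
  have h1 : f ∈ mI y u (wset L m (min l0 l)) := mI_mono (wset_anti hL hmin (min_le_left _ _)) hf
  have h2 : y' - e * y ∈ mI y' u {t | t.2 = 0 ∧ l ≤ lam L t.1} := by
    rwa [mI_congr_zero (y' := y')] at h
    exact fun t ht => ht.1
  have h3 := zero_fil (min_le_right l0 l) h2
  refine change_le (l := min l0 l) ?_ h1
  obtain ⟨e, rfl⟩ := he
  have : y = ↑e⁻¹ * (y' - (y' - ↑e * y)) := by
    rw [sub_sub_cancel, ← mul_assoc, Units.inv_mul, one_mul]
  rw [this]
  exact Ideal.mul_mem_left _ _ (Ideal.sub_mem _ y_mem_fil h3)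

theorem lead_unit (hL : ∀ i, 0 < L i) (hy : IsPar y u) {l0 l : ℝ} (hl : 0 < l) (hll : l < l0)
    {m : ℕ} {f : A} (hf : f ∈ mI y u (wset L m l0))
    (hfm : f ∉ maximalIdeal A ^ (m + 1) ⊔ Ideal.span (Set.range u)) :
    ∃ C, IsUnit C ∧ f - C * y ^ m ∈ mI y u {t | l * m < weight l L t} := by
  have hsub : wset L m l0 ⊆ {t | l * m < weight l L t} ∪ {(0, m)} := by
    intro t ht
    rw [mem_wset] at ht
    by_cases hb : m ≤ t.2
    · by_cases hte : t = (0, m)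
      · exact Or.inr hte
      · left
        have hlt : ((0, m) : Ex d) < t := lt_of_le_of_ne ⟨fun j => Nat.zero_le _, hb⟩ (Ne.symm hte)
        have := weight_strict hL hl hlt
        simp only [Set.mem_setOf_eq]
        refine lt_of_le_of_lt ?_ this
        simp [weight]
    · left
      simp only [Set.mem_setOf_eq, weight_eq]
      have : (t.2 : ℝ) < m := by exact_mod_cast not_le.mp hb
      nlinarith
  have h1 := mI_mono hsub hf
  rw [mI_sup] at h1
  obtain ⟨r, hr, q, hq, rfl⟩ := Submodule.mem_sup.mp h1
  unfold mI at hq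
  rw [Set.image_singleton, monomial_y] at hq
  obtain ⟨C, rfl⟩ := Ideal.mem_span_singleton'.mp hq
  refine ⟨C, ?_, by simpa using hr⟩
  by_contra hnu
  apply hfm
  have hC : C ∈ maximalIdeal A := hnu
  have hym : y ∈ maximalIdeal A := hy ▸ Ideal.subset_span (Set.mem_insert _ _)
  refine Ideal.add_mem _ ?_ ?_
  · have hs : {t : Ex d | l * m < weight l L t} ⊆ {t | m + 1 ≤ deg t} ∪ {t | t.1 ≠ 0} := by
      intro t ht
      by_cases h0 : t.1 = 0
      · left
        simp only [Set.mem_setOf_eq, weight_eq, h0] at ht ⊢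
        simp [lam] at ht
        have : (m : ℝ) < t.2 := by nlinarith
        have : m < t.2 := by exact_mod_cast this
        simp [deg]; omega
      · exact Or.inr h0
    have h2 := mI_mono hs hr
    rw [mI_sup] at h2
    exact sup_le_sup (mI_le_pow hy (m+1)) mI_le_span_u h2
  · apply Ideal.mem_sup_left
    rw [pow_succ']
    exact Ideal.mul_mem_mul hC (Ideal.pow_mem_pow hym _)

theorem cmp_ii (hL : ∀ i, 0 < L i) (hy : IsPar y u) {l0 : ℝ}
    {m : ℕ} {f : A} (hf : f ∈ mI y u (wset L m l0))
    (hfm : f ∉ maximalIdeal A ^ (m + 1) ⊔ Ideal.span (Set.range u))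
    {w : Fin d → ℕ} {c e : A} (hcu : IsUnit c) (he : IsUnit e)
    (hw : 0 < lam L w) (hwl : lam L w < l0)
    (h : y' - c * monomial y u (w, 0) - e * y ∈ mI y u {t | t.2 = 0 ∧ lam L w < lam L t.1}) :
    (∃ C, IsUnit C ∧
      f - C * monomial y' u (m • w, 0) ∈ mI y' u {t | ¬ t ≤ (m • w, 0)}) ∧
    IsPar (y' - c * monomial y' u (w, 0)) u ∧
    ∃ l, lam L w < l ∧ f ∈ mI (y' - c * monomial y' u (w, 0)) u (wset L m l) := by
  have hmm : monomial y u (w, 0) = monomial y' u (w, 0) := by simp [monomial]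
  rw [hmm] at h
  set z := y' - c * monomial y' u (w, 0) with hz
  set μ := lam L w with hμ
  obtain ⟨C, hC, hr⟩ := lead_unit hL hy hw hwl hf hfm
  have hk : ∀ x : A, z - e * y ∈ mI x u {t | μ < weight μ L t} := by
    intro x
    apply zero_fil_lt
    rwa [mI_congr_zero (y' := x)] at h
    exact fun t ht => ht.1
  have hpar : IsPar z u := par_of hy he (lam_set_le_u hL hw (fun t ht => le_of_lt ht.2) h)
  obtain ⟨e, rfl⟩ := he
  have hyz : y = ↑e⁻¹ * (z + -(z - ↑e * y)) := by
    rw [← sub_eq_add_neg, sub_sub_cancel, ← mul_assoc, Units.inv_mul, one_mul]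
  have hnk := fun x => neg_mem (hk x)
  have hyfil : y ∈ mI z u {t | μ ≤ weight μ L t} := by
    rw [hyz]
    exact Ideal.mul_mem_left _ _ (Ideal.add_mem _ y_mem_fil (lt_fil_le (hnk z)))
  have hrz := change_lt hyfil hr
  have hps := (pow_sub_pow_mem (y_mem_fil (y := z) (u := u) (l := μ) (L := L)) (hnk z) m).1
  let C' := C * ((e⁻¹ : Aˣ) : A) ^ m
  have hC' : IsUnit C' := hC.mul ((e⁻¹).isUnit.pow m)
  have hf1 : f - C' * z ^ m ∈ mI z u {t | μ * m < weight μ L t} := by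
    have := Ideal.add_mem _ hrz (Ideal.mul_mem_left _ C' hps)
    convert this using 1
    have h5 : y ^ m = ((e⁻¹ : Aˣ) : A) ^ m * (z + -(z - ↑e * y)) ^ m := by
      rw [← mul_pow, ← hyz]
    rw [h5]
    simp only [C']; ring
  refine ⟨?_, hpar, ?_⟩
  · have hwt : weight μ L ((w, 0) : Ex d) = μ := by simp [weight_eq, hμ]
    have hzf : z ∈ mI y' u {t | μ ≤ weight μ L t} :=
      Ideal.sub_mem _ y_mem_fil (Ideal.mul_mem_left _ _ (Ideal.subset_span ⟨_, hwt.ge, rfl⟩))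
    have hf2 := change_lt hzf hf1
    refine ⟨C' * (-c) ^ m, hC'.mul (hcu.neg.pow m), ?_⟩
    have hd : y' ∣ z ^ m - (-(c * monomial y' u (w, 0))) ^ m := by
      have := sub_dvd_pow_sub_pow z (-(c * monomial y' u (w, 0))) m
      have h6 : z - -(c * monomial y' u (w, 0)) = y' := by rw [hz]; ring
      rwa [h6] at this
    obtain ⟨q, hq⟩ := hd
    have hmp : (monomial y' u (w, 0)) ^ m = monomial y' u (m • w, 0) := by
      rw [← monomial_nsmul]; simp
    have hA : f - C' * z ^ m ∈ mI y' u {t | ¬ t ≤ (m • w, 0)} := by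
      refine mI_mono ?_ hf2
      intro t ht hle
      have h7 := weight_mono hL hw hle
      have h8 : weight μ L ((m • w, 0) : Ex d) = μ * m := by
        rw [weight_eq, lam_nsmul]; simp [hμ]; ring
      simp only [Set.mem_setOf_eq] at ht
      linarith
    have hB : y' ∈ mI y' u {t | ¬ t ≤ (m • w, 0)} := by
      have : monomial y' u (0, 1) ∈ mI y' u {t | ¬ t ≤ (m • w, 0)} := by
        refine Ideal.subset_span ⟨(0, 1), ?_, rfl⟩
        intro hle
        have := hle.2
        simp at this
      rwa [monomial_y'] at this
    have := Ideal.add_mem _ hA (Ideal.mul_mem_left _ (C' * q) hB)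
    convert this using 1
    have h9 : z ^ m = y' * q + (-c) ^ m * monomial y' u (m • w, 0) := by
      rw [← hq, ← hmp, ← mul_pow]; ring
    rw [h9]; ring
  · apply wset_improve hL hw
    have hs : {t : Ex d | μ * m < weight μ L t} ⊆ {t | m ≤ t.2 ∨ μ * m < weight μ L t} :=
      fun t ht => Or.inr ht
    have h1 := mI_mono hs hf1
    have h2 : z ^ m ∈ mI z u {t | m ≤ t.2 ∨ μ * m < weight μ L t} := by
      rw [← monomial_y z u m]
      exact Ideal.subset_span ⟨(0, m), Or.inl le_rfl, rfl⟩
    have := Ideal.add_mem _ h1 (Ideal.mul_mem_left _ C' h2)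
    rwa [sub_add_cancel] at this

end Cmp2

section CaseI
variable {d : ℕ} {A : Type u} [CommRing A] [IsLocalRing A] {y y' : A} {u : Fin d → A}
  {L : Fin d → ℝ}

theorem par_of_sq (hy : IsPar y u) {e : A} (he : IsUnit e)
    (h : y' - e * y ∈ maximalIdeal A ^ 2) : IsPar y' u := by
  have hfg : (maximalIdeal A).FG := by
    rw [← hy]
    exact (Submodule.fg_span ((Set.finite_range u).insert y))
  have hum : Ideal.span (Set.range u) ≤ maximalIdeal A := by
    rw [← hy]; exact Ideal.span_mono (Set.subset_insert _ _)
  have hym : y ∈ maximalIdeal A := hy ▸ Ideal.subset_span (Set.mem_insert _ _)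
  have hsq : maximalIdeal A ^ 2 ≤ maximalIdeal A := Ideal.pow_le_self two_ne_zero
  apply le_antisymm
  · rw [Ideal.span_insert]
    refine sup_le ?_ hum
    rw [Ideal.span_singleton_le_iff_mem, ← sub_add_cancel y' (e * y)]
    exact Ideal.add_mem _ (hsq h) (Ideal.mul_mem_left _ _ hym)
  · refine Submodule.le_of_le_smul_of_le_jacobson_bot hfg
      (IsLocalRing.maximalIdeal_le_jacobson _) ?_
    conv_lhs => rw [← hy]
    rw [Ideal.span_insert]
    refine sup_le ?_ ?_
    · rw [Ideal.span_singleton_le_iff_mem]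
      obtain ⟨e, rfl⟩ := he
      have : y = ↑e⁻¹ * y' - ↑e⁻¹ * (y' - ↑e * y) := by
        rw [mul_sub, ← mul_assoc, Units.inv_mul]; ring
      rw [this]
      refine Ideal.sub_mem _ (Ideal.mem_sup_left (Ideal.mul_mem_left _ _
        (Ideal.subset_span (Set.mem_insert _ _)))) (Ideal.mem_sup_right (Ideal.mul_mem_left _ _ ?_))
      rw [smul_eq_mul, ← pow_two]; exact h
    · exact le_sup_of_le_left (Ideal.span_mono (Set.subset_insert _ _))

theorem lam_le_deg (hL : ∀ i, 0 < L i) (t : Ex d) :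
    lam L t.1 ≤ (1 + ∑ i, L i) * deg t := by
  have h1 : lam L t.1 ≤ (∑ i, L i) * ∑ i, (t.1 i : ℝ) := by
    unfold lam
    rw [Finset.mul_sum]
    apply Finset.sum_le_sum
    intro i _
    apply mul_le_mul_of_nonneg_right _ (Nat.cast_nonneg _)
    exact Finset.single_le_sum (f := L) (fun j _ => (hL j).le) (Finset.mem_univ i)
  have h2 : (0:ℝ) ≤ ∑ i, L i := Finset.sum_nonneg (fun j _ => (hL j).le)
  have h3 : ∑ i, (t.1 i : ℝ) ≤ deg t := by
    unfold deg; push_cast; simp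
  have h4 : (0:ℝ) ≤ deg t := Nat.cast_nonneg _
  nlinarith

theorem caseI [IsAdicComplete (maximalIdeal A) A] (hL : ∀ i, 0 < L i)
    (hind : ∀ q : Fin d → ℤ, ∑ i, L i * (q i : ℝ) = 0 → q = 0)
    (hcore : ∀ y, IsPar y u → CoreProp y u) {m : ℕ} (hm : 1 ≤ m) {f : A}
    (hfm : f ∉ maximalIdeal A ^ (m + 1) ⊔ Ideal.span (Set.range u))
    (hunb : ∀ C : ℝ, ∃ l, C < l ∧ ∃ y, IsPar y u ∧ f ∈ mI y u (wset L m l)) :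
    ∃ y, IsPar y u ∧ ∃ g, IsUnit g ∧ f = g * y ^ m := by
  set Lm : ℝ := 1 + ∑ i, L i with hLm
  have hLm0 : 0 < Lm := by
    have h2 : (0:ℝ) ≤ ∑ i, L i := Finset.sum_nonneg (fun j _ => (hL j).le)
    linarith
  have hm' : (1 : ℝ) ≤ m := by exact_mod_cast hm
  have h1 : ∀ n : ℕ, ∃ y, IsPar y u ∧ f ∈ mI y u (wset L m ((n + 1) * Lm)) := by
    intro n
    obtain ⟨l, hl, y, hy, hf⟩ := hunb ((n + 1) * Lm)
    exact ⟨y, hy, mI_mono (wset_anti hL (by positivity) hl.le) hf⟩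
  choose Y hY hfY using h1
  have h2 : ∀ n, ∃ e, IsUnit e ∧ Y n - e * Y (n + 1) ∈ maximalIdeal A ^ n := by
    intro n
    rcases cmp_raw hL hind (hY n) (hcore _ (hY n)) (hY (n+1)) (n * Lm) with
      ⟨l, hl1, hl, e, he, h⟩ | ⟨w, c, e, hc, he, hw, hwl, h⟩
    · refine ⟨e, he, mI_le_pow (hY (n+1)) n (mI_mono ?_ h)⟩
      rintro t ⟨_, ht⟩
      have h3 := lam_le_deg hL t
      have h4 : (n : ℝ) * Lm < Lm * deg t := by linarith
      have h5 : (n : ℝ) < deg t := by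
        rw [mul_comm] at h4
        exact lt_of_mul_lt_mul_left h4 hLm0.le
      have h6 : n < deg t := by exact_mod_cast h5
      exact h6.le
    · exfalso
      have hlt : lam L w < ((n + 1 : ℕ) + 1) * Lm := by push_cast; nlinarith
      obtain ⟨⟨C, hC, hr⟩, _, _⟩ := cmp_ii hL (hY (n+1)) (hfY (n+1)) hfm hc he hw hlt h
      obtain ⟨t, ht, hle⟩ := lemmaB (hcore _ (hY n)) hC (hfY n) hr
      rw [mem_wset] at ht
      have hb : t.2 = 0 := Nat.le_zero.mp hle.2
      have h3 := lam_mono hL hle.1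
      simp only [lam_nsmul] at h3
      rw [hb] at ht
      simp only [Nat.cast_zero, sub_zero] at ht
      have h4 : (m : ℝ) * lam L w ≤ m * (n * Lm) := by gcongr
      nlinarith
  choose e he hYe using h2
  let v : ℕ → A := fun n => ∏ i ∈ Finset.range n, e i
  have hv : ∀ n, IsUnit (v n) := by
    intro n
    induction n with
    | zero => simp [v]
    | succ n ih =>
      simp only [v, Finset.prod_range_succ] at ih ⊢
      exact ih.mul (he n)
  obtain ⟨Z, hZ⟩ := prec_S (fun n => v n * Y n) (by
    intro n
    have : v (n+1) * Y (n+1) - v n * Y n = -(v n * (Y n - e n * Y (n+1))) := by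
      simp only [v, Finset.prod_range_succ]; ring
    simp only [this]
    exact neg_mem (Ideal.mul_mem_left _ _ (hYe n)))
  have hZp : IsPar Z u := par_of_sq (hY 2) (hv 2) (hZ 2)
  have hfn : ∀ n, f ∈ mI Z u ({(0, m)} ∪ {t | deg t = n}) := by
    intro n
    have hs : wset L m ((n + 1) * Lm) ⊆ {t | m ≤ t.2} ∪ {t | n ≤ deg t} := by
      intro t ht
      by_cases hb : m ≤ t.2
      · exact Or.inl hb
      · right
        rw [mem_wset] at ht
        have h3 := lam_le_deg hL t
        have hb' : (t.2 : ℝ) + 1 ≤ m := by exact_mod_cast not_le.mp hb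
        have h0 : 0 ≤ (n + 1) * Lm := by positivity
        have h4 : (n + 1) * Lm ≤ (n + 1) * Lm * (m - t.2) := by nlinarith
        have h5 : Lm * (n : ℝ) ≤ Lm * deg t := by nlinarith
        have h6 : (n : ℝ) ≤ deg t := le_of_mul_le_mul_left h5 hLm0
        exact_mod_cast h6
    have h7 := mI_mono hs (hfY n)
    rw [mI_sup] at h7
    have h8 := sup_le_sup (mI_le_span_ym m) (mI_le_pow (hY n) n) h7
    rw [mI_sup]
    have hmI : mI Z u {(0, m)} = Ideal.span {Z ^ m} := by
      unfold mI; rw [Set.image_singleton, monomial_y]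
    rw [hmI]
    suffices hh : Ideal.span {Y n ^ m} ⊔ maximalIdeal A ^ n ≤
        Ideal.span {Z ^ m} ⊔ mI Z u {t | deg t = n} from hh h8
    refine sup_le ?_ ?_
    · rw [Ideal.span_singleton_le_iff_mem]
      have h9 : Z ^ m - (v n * Y n) ^ m ∈ maximalIdeal A ^ n :=
        Ideal.mem_of_dvd _ (sub_dvd_pow_sub_pow _ _ m) (hZ n)
      obtain ⟨w, hw⟩ := (hv n).pow m
      have h10 : Y n ^ m = ↑w⁻¹ * Z ^ m - ↑w⁻¹ * (Z ^ m - (v n * Y n) ^ m) := by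
        rw [mul_pow, ← hw, mul_sub, ← mul_assoc _ _ (Y n ^ m), Units.inv_mul]; ring
      rw [h10]
      exact Ideal.sub_mem _ (Ideal.mem_sup_left (Ideal.mul_mem_left _ _
        (Ideal.mem_span_singleton_self _))) (Ideal.mem_sup_right (Ideal.mul_mem_left _ _
          (pow_le_mI hZp n h9)))
    · exact le_sup_of_le_right (pow_le_mI hZp n)
  obtain ⟨c, hc⟩ := unit_expansion hZp f
  have hfin : f ∈ mI Z u {t | m ≤ t.2} := by
    refine mem_mI_iff.mpr ⟨c, ?_, hc.2⟩
    intro t ht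
    obtain ⟨t', ht', hle⟩ := lemmaB_exp (hcore _ hZp) hc (hfn (deg t + 1)) ht
    rcases ht' with rfl | ht'
    · exact hle.2
    · have := deg_mono hle
      simp only [Set.mem_setOf_eq] at ht'
      omega
  obtain ⟨g, hg⟩ := Ideal.mem_span_singleton'.mp (mI_le_span_ym m hfin)
  refine ⟨Z, hZp, g, ?_, hg.symm⟩
  by_contra hnu
  apply hfm
  apply Ideal.mem_sup_left
  rw [← hg, pow_succ']
  have hZm : Z ∈ maximalIdeal A := hZp ▸ Ideal.subset_span (Set.mem_insert _ _)
  exact Ideal.mul_mem_mul (show g ∈ maximalIdeal A from hnu) (Ideal.pow_mem_pow hZm _)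

end CaseI

section CaseII
variable {d : ℕ}

theorem fsub_up {D : Set (Fin d → ℝ)} (hD : IsFSubset D) {p q : Fin d → ℝ} (hp : p ∈ D)
    (h : ∀ i, p i ≤ q i) : q ∈ D := by
  have := hD.2.2.2 p hp (q - p) (fun i => by simpa using h i)
  rwa [add_sub_cancel] at this

theorem proj_up {D : Set (Fin d → ℝ)} (hD : IsFSubset D) {m : ℕ} {t t' : Ex d} (h : t ≤ t')
    (ht' : t'.2 < m) (ht : projPoint m t ∈ D) : projPoint m t' ∈ D := by
  refine fsub_up hD ht (fun i => ?_)
  unfold projPoint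
  have h1 : (t'.2 : ℝ) < m := by exact_mod_cast ht'
  have h2 : (t.2 : ℝ) ≤ t'.2 := by exact_mod_cast h.2
  have h3 : (t.1 i : ℝ) ≤ t'.1 i := by exact_mod_cast h.1 i
  apply div_le_div₀ (Nat.cast_nonneg _) h3 (by linarith) (by linarith)

theorem proj_eq {L : Fin d → ℝ} (hind : ∀ q : Fin d → ℤ, ∑ i, L i * (q i : ℝ) = 0 → q = 0)
    {m : ℕ} {l : ℝ} {t t' : Ex d} (hb : t.2 < m) (hb' : t'.2 < m)
    (h : weight l L t = l * m) (h' : weight l L t' = l * m) : projPoint m t = projPoint m t' := by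
  have h1 : (t'.2 : ℝ) < m := by exact_mod_cast hb'
  have h2 : (t.2 : ℝ) < m := by exact_mod_cast hb
  have h3 : lam L t.1 = l * (m - t.2) := by rw [weight_eq] at h; linarith
  have h4 : lam L t'.1 = l * (m - t'.2) := by rw [weight_eq] at h'; linarith
  have := hind (fun i => (t.1 i : ℤ) * ((m : ℤ) - t'.2) - t'.1 i * ((m : ℤ) - t.2)) (by
    have h5 : lam L t.1 * (m - t'.2) - lam L t'.1 * (m - t.2) = 0 := by rw [h3, h4]; ring
    rw [← h5]
    simp only [lam, Finset.sum_mul, ← Finset.sum_sub_distrib]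
    apply Finset.sum_congr rfl
    intro i _
    push_cast; ring)
  funext i
  have h6 := congrFun this i
  simp only [Pi.zero_apply] at h6
  unfold projPoint
  rw [div_eq_div_iff (by linarith) (by linarith)]
  have h7 : ((t.1 i : ℤ) * ((m : ℤ) - t'.2)) = t'.1 i * ((m : ℤ) - t.2) := by linarith
  exact_mod_cast h7

theorem proj_shift {D : Set (Fin d → ℝ)} (hD : IsFSubset D) {m : ℕ} {w a : Fin d → ℕ} {k j : ℕ}
    (hw : (fun i => (w i : ℝ)) ∈ D) (h : m ≤ k + j ∨ projPoint m (a, k + j) ∈ D) :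
    m ≤ k ∨ projPoint m (a + j • w, k) ∈ D := by
  by_cases hk : m ≤ k
  · exact Or.inl hk
  right
  have hk' : (k : ℝ) < m := by exact_mod_cast not_le.mp hk
  by_cases hkj : m ≤ k + j
  · have h1 : (m : ℝ) ≤ k + j := by exact_mod_cast hkj
    refine fsub_up hD hw (fun i => ?_)
    unfold projPoint
    rw [le_div_iff₀ (by simpa using hk')]
    simp only [Pi.add_apply, Pi.smul_apply, smul_eq_mul]
    push_cast
    have : (0:ℝ) ≤ w i := Nat.cast_nonneg _
    have : (0:ℝ) ≤ a i := Nat.cast_nonneg _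
    nlinarith
  · have hp := h.resolve_left hkj
    have h1 : (k : ℝ) + j < m := by exact_mod_cast not_le.mp hkj
    have hj : (0:ℝ) ≤ j := Nat.cast_nonneg _
    have hpos : (0:ℝ) < m - k := by linarith
    have := hD.2.2.1 hp hw (show (0:ℝ) ≤ ((m:ℝ) - k - j) / (m - k) from
      div_nonneg (by linarith) hpos.le) (show (0:ℝ) ≤ (j:ℝ) / (m - k) from
      div_nonneg hj hpos.le) (by
        rw [← add_div, sub_add_cancel, div_self hpos.ne'])
    convert this using 1
    funext i
    simp only [projPoint, Pi.add_apply, Pi.smul_apply, smul_eq_mul]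
    push_cast
    have h2 : (m : ℝ) - (k + j) ≠ 0 := by linarith
    have h3 := hpos.ne'
    field_simp
    ring

variable {A : Type u} [CommRing A] {y y' : A} {u : Fin d → A} {L : Fin d → ℝ}

theorem change_D {D : Set (Fin d → ℝ)} (hD : IsFSubset D) {m : ℕ} {w : Fin d → ℕ} (c : A)
    (hw : (fun i => (w i : ℝ)) ∈ D) :
    mI y' u {t | m ≤ t.2 ∨ projPoint m t ∈ D} ≤
      mI (y' - c * monomial y' u (w, 0)) u {t | m ≤ t.2 ∨ projPoint m t ∈ D} := by
  set z := y' - c * monomial y' u (w, 0) with hz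
  conv_lhs => unfold mI
  rw [Ideal.span_le]
  rintro _ ⟨⟨a, b⟩, ht, rfl⟩
  have h0 : ∀ a : Fin d → ℕ, monomial y' u (a, 0) = monomial z u (a, 0) := by
    intro a; simp [monomial]
  have hy : y' = z + c * monomial z u (w, 0) := by rw [← h0, hz]; ring
  have h1 : monomial y' u (a, b) = y' ^ b * monomial z u (a, 0) := by simp [monomial]
  have h2 : y' ^ b = (z + c * monomial z u (w, 0)) ^ b := by rw [← hy]
  rw [SetLike.mem_coe, h1, h2, add_pow, Finset.sum_mul]
  refine Ideal.sum_mem _ (fun k hk => ?_)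
  have hkb : k ≤ b := Nat.lt_succ_iff.mp (Finset.mem_range.mp hk)
  have h3 : z ^ k * (c * monomial z u (w, 0)) ^ (b - k) * ↑(b.choose k) * monomial z u (a, 0) =
      (c ^ (b-k) * ↑(b.choose k)) * monomial z u (a + (b-k) • w, k) := by
    have : ((a + (b-k) • w, k) : Ex d) = (0, k) + ((b-k) • (w, 0) + (a, 0)) := by
      ext <;> simp [add_comm]
    rw [this, monomial_add, monomial_add, monomial_nsmul, monomial_y, mul_pow]; ring
  rw [h3]
  refine Ideal.mul_mem_left _ _ (Ideal.subset_span ⟨_, ?_, rfl⟩)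
  apply proj_shift hD hw
  rw [Nat.add_sub_cancel' hkb]
  exact ht

variable [IsLocalRing A]

theorem fil_start (hL : ∀ i, 0 < L i) (hy : IsPar y u) {m : ℕ} (hm : 1 ≤ m) {f : A}
    (hf : f ∈ maximalIdeal A ^ m ⊔ Ideal.span (Set.range u)) :
    ∃ l, 0 < l ∧ f ∈ mI y u (wset L m l) := by
  obtain ⟨l, hl, hlL⟩ := exists_mu0 hL
  have hm' : (0:ℝ) < m := by exact_mod_cast hm
  refine ⟨l / m, by positivity, ?_⟩
  have h0 : ∀ t : Ex d, t.1 ≠ 0 → t ∈ wset L m (l / m) := by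
    intro t ht
    rw [mem_wset]
    obtain ⟨i, hi⟩ := Function.ne_iff.mp ht
    have h1 : L i * t.1 i ≤ lam L t.1 := by
      unfold lam
      exact Finset.single_le_sum (f := fun i => L i * (t.1 i : ℝ))
        (fun j _ => mul_nonneg (hL j).le (Nat.cast_nonneg _)) (Finset.mem_univ i)
    have h2 : (1:ℝ) ≤ t.1 i := by exact_mod_cast Nat.one_le_iff_ne_zero.mpr hi
    have h3 := hlL i
    have h4 : l / m * (m - t.2) ≤ l / m * m := by
      apply mul_le_mul_of_nonneg_left _ (by positivity)
      have : (0:ℝ) ≤ t.2 := Nat.cast_nonneg _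
      linarith
    rw [div_mul_cancel₀ _ hm'.ne'] at h4
    nlinarith
  suffices hh : maximalIdeal A ^ m ⊔ Ideal.span (Set.range u) ≤ mI y u (wset L m (l / m)) from hh hf
  refine sup_le ((pow_le_mI hy m).trans (mI_mono ?_)) ((span_u_le_mI (y := y)).trans (mI_mono h0))
  intro t ht
  by_cases ht0 : t.1 = 0
  · apply mem_wset_of_le hL (by positivity)
    simp [deg, ht0] at ht
    exact ht.ge
  · exact h0 t ht0

theorem caseII [IsAdicComplete (maximalIdeal A) A] (hL : ∀ i, 0 < L i)
    (hind : ∀ q : Fin d → ℤ, ∑ i, L i * (q i : ℝ) = 0 → q = 0)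
    (hcore : ∀ y, IsPar y u → CoreProp y u) {m : ℕ} (hm : 1 ≤ m) {f : A}
    (hfm0 : f ∈ maximalIdeal A ^ m ⊔ Ideal.span (Set.range u))
    (hfm : f ∉ maximalIdeal A ^ (m + 1) ⊔ Ideal.span (Set.range u))
    (hy : IsPar y u) {C : ℝ}
    (hbd : ∀ l, 0 < l → ∀ y, IsPar y u → f ∈ mI y u (wset L m l) → l ≤ C) :
    ∃ v, ∀ y, IsPar y u → v ∈ DeltaOf f y u m := by
  obtain ⟨l0, hl0, hfl0⟩ := fil_start hL hy hm hfm0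
  obtain ⟨ls, hls, ⟨y0, hy0, hf0⟩, hmax⟩ := max_attained hL m
    (fun l => ∃ y, IsPar y u ∧ f ∈ mI y u (wset L m l))
    (fun l l' _ _ hs ⟨y, h1, h2⟩ => ⟨y, h1, mI_mono hs h2⟩) hl0 ⟨y, hy, hfl0⟩ (C := C)
    (fun l hl ⟨y, h1, h2⟩ => hbd l hl y h1 h2)
  push Not at hmax
  obtain ⟨t, htm, htw, c, hc, hr⟩ := exact_term hL hy0 hls hf0 (fun l' hl' => hmax l' hl' y0 hy0)
  refine ⟨projPoint m t, ?_⟩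
  intro y' hy'
  simp only [DeltaOf, smallestFSubset, Set.mem_sInter]
  rintro D ⟨hD, hX⟩
  have hfD : f ∈ mI y' u {t | m ≤ t.2 ∨ projPoint m t ∈ D} := by
    obtain ⟨c, hc⟩ := unit_expansion hy' f
    refine mem_mI_iff.mpr ⟨c, ?_, hc.2⟩
    intro t ht
    by_cases hb : m ≤ t.2
    · exact Or.inl hb
    · right
      apply hX
      simp only [Set.mem_iUnion]
      exact ⟨c, hc, t, ht, not_le.mp hb, rfl⟩
  obtain ⟨l0', hl0', hfl0'⟩ := fil_start hL hy' hm hfm0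
  obtain ⟨l1, hl1, ⟨y1, hy1, hf1, hf1D⟩, hmax1⟩ := max_attained hL m
    (fun l => ∃ y, IsPar y u ∧ f ∈ mI y u (wset L m l) ∧
      f ∈ mI y u {t | m ≤ t.2 ∨ projPoint m t ∈ D})
    (fun l l' _ _ hs ⟨y, h1, h2, h3⟩ => ⟨y, h1, mI_mono hs h2, h3⟩) hl0' ⟨y', hy', hfl0', hfD⟩
    (C := C) (fun l hl ⟨y, h1, h2, _⟩ => hbd l hl y h1 h2)
  push Not at hmax1
  have hle : l1 ≤ ls := by
    by_contra hcon
    exact hmax l1 (not_le.mp hcon) y1 hy1 hf1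
  rcases hle.eq_or_lt with heq | hlt
  · subst heq
    obtain ⟨t', htm', htw', c', hc', hr'⟩ := exact_term hL hy1 hl1 hf1
      (fun l' hl' h => hmax l' hl' y1 hy1 h)
    rw [proj_eq hind htm htm' htw htw']
    obtain ⟨s, hs, hst⟩ := lemmaB (hcore _ hy1) hc' hf1D
      (mI_mono (fun s hs => not_le_of_wset hL hl1 htw' hs) hr')
    refine proj_up hD hst htm' (hs.resolve_left ?_)
    have := hst.2
    omega
  · exfalso
    rcases cmp_raw hL hind hy1 (hcore _ hy1) hy0 l1 with
      ⟨l, hll, hl, e, he, h⟩ | ⟨w, c, e, hc, he, hw, hwl, h⟩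
    · have := cmp_i hL hls hl hf0 he h
      exact hmax1 _ (lt_min hlt hll) y1 hy1 this hf1D
    · obtain ⟨⟨C, hC, hr⟩, hzp, l, hl, hfz⟩ :=
        cmp_ii hL hy0 hf0 hfm hc he hw (lt_of_le_of_lt hwl hlt) h
      have hm' : (0:ℝ) < m := by exact_mod_cast hm
      have hw1 : l1 ≤ lam L w := by
        obtain ⟨s, hs, hst⟩ := lemmaB (hcore _ hy1) hC hf1 hr
        rw [mem_wset] at hs
        have hb : s.2 = 0 := Nat.le_zero.mp hst.2
        have h3 := lam_mono hL hst.1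
        simp only [lam_nsmul] at h3
        rw [hb] at hs
        simp only [Nat.cast_zero, sub_zero] at hs
        by_contra hcon
        nlinarith
      have hwD : (fun i => (w i : ℝ)) ∈ D := by
        obtain ⟨s, hs, hst⟩ := lemmaB (hcore _ hy1) hC hf1D hr
        have hb : s.2 = 0 := Nat.le_zero.mp hst.2
        have h3 := proj_up hD (m := m) hst (show 0 < m by omega) (hs.resolve_left (by omega))
        convert h3 using 1
        funext i
        simp only [projPoint, Pi.smul_apply, smul_eq_mul]
        push_cast
        rw [sub_zero, mul_comm, mul_div_cancel_right₀ _ hm'.ne']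
      exact hmax1 l (lt_of_le_of_lt hw1 hl) _ hzp hfz (change_D hD c hwD hf1D)

theorem part1 [IsAdicComplete (maximalIdeal A) A]
    (hcore : ∀ y, IsPar y u → CoreProp y u) {m : ℕ} (hm : 1 ≤ m) {f : A}
    (hfm0 : f ∈ maximalIdeal A ^ m ⊔ Ideal.span (Set.range u))
    (hfm : f ∉ maximalIdeal A ^ (m + 1) ⊔ Ideal.span (Set.range u))
    (hy : IsPar y u) (hempty : ∀ v, ∃ y, IsPar y u ∧ v ∉ DeltaOf f y u m) :
    ∃ y, IsPar y u ∧ ∃ g, IsUnit g ∧ f = g * y ^ m := by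
  obtain ⟨L, hL, hind⟩ := exists_Lam d
  by_cases hunb : ∀ C : ℝ, ∃ l, C < l ∧ ∃ y, IsPar y u ∧ f ∈ mI y u (wset L m l)
  · exact caseI hL hind hcore hm hfm hunb
  · exfalso
    push Not at hunb
    obtain ⟨C, hC⟩ := hunb
    obtain ⟨v, hv⟩ := caseII hL hind hcore hm hfm0 hfm hy (C := C) (by
      intro l _ y hy hf
      by_contra hcon
      exact hC l (not_le.mp hcon) y hy hf)
    obtain ⟨y', hy', hv'⟩ := hempty v
    exact hv' (hv y' hy')

end CaseII

section Compl
variable {d : ℕ} {A : Type u} [CommRing A] [IsLocalRing A]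

theorem isPar_of_rsp {y : A} {u : Fin d → A} (h : IsRSP A y u) : IsPar y u := by
  have := h.1
  rwa [Fin.range_cons] at this

theorem rsp_of_isPar {y y' : A} {u : Fin d → A} (h : IsRSP A y u) (h' : IsPar y' u) :
    IsRSP A y' u := by
  refine ⟨?_, h.2⟩
  rw [Fin.range_cons]; exact h'

theorem krull_closed [IsNoetherianRing A] (I : Ideal A) {x : A}
    (h : ∀ n, x ∈ I ⊔ maximalIdeal A ^ n) : x ∈ I := by
  rw [← Ideal.Quotient.eq_zero_iff_mem]
  refine IsHausdorff.haus' (I := maximalIdeal A) (M := A ⧸ I) _ (fun n => ?_)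
  rw [SModEq.zero]
  obtain ⟨p, hp, q, hq, rfl⟩ := Submodule.mem_sup.mp (h n)
  rw [map_add, Ideal.Quotient.eq_zero_iff_mem.mpr hp, zero_add]
  have : Ideal.Quotient.mk I q = q • (1 : A ⧸ I) := by
    rw [Algebra.smul_def, mul_one]; rfl
  rw [this]
  exact Submodule.smul_mem_smul hq trivial

theorem coreR [IsNoetherianRing A] {y : A} {u : Fin d → A} (h : IsRSP A y u) : CoreProp y u := by
  intro e he
  refine core h (Fin.cons e.2 e.1) ?_
  have h1 : ∏ i, (Fin.cons y u : Fin (d+1) → A) i ^ (Fin.cons e.2 e.1 : Fin (d+1) → ℕ) i =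
      monomial y u e := by
    rw [Fin.prod_univ_succ]; simp [monomial]
  rw [h1]
  refine (?_ : mI y u {t | ¬ t ≤ e} ≤ _) he
  unfold mI
  rw [Ideal.span_le]
  rintro _ ⟨t, ht, rfl⟩
  by_cases hb : t.2 ≤ e.2
  · have : ∃ i, e.1 i < t.1 i := by
      by_contra hcon
      push Not at hcon
      exact ht ⟨hcon, hb⟩
    obtain ⟨i, hi⟩ := this
    have h2 : u i ^ (e.1 i + 1) ∣ monomial y u t :=
      Dvd.dvd.mul_left ((pow_dvd_pow _ hi).trans
        (Finset.dvd_prod_of_mem (fun i => u i ^ t.1 i) (Finset.mem_univ i))) _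
    refine Ideal.mem_of_dvd _ h2 (Ideal.subset_span ⟨i.succ, by simp⟩)
  · have h2 : y ^ (e.2 + 1) ∣ monomial y u t :=
      Dvd.dvd.mul_right (pow_dvd_pow _ (not_le.mp hb)) _
    refine Ideal.mem_of_dvd _ h2 (Ideal.subset_span ⟨0, by simp⟩)

theorem mI_map {B : Type v} [CommRing B] (φ : A →+* B) (y : A) (u : Fin d → A) (T : Set (Ex d)) :
    (mI y u T).map φ = mI (φ y) (fun i => φ (u i)) T := by
  unfold mI
  rw [Ideal.map_span, Set.image_image]
  congr 1
  apply Set.image_congr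
  intro t _
  simp [monomial]

/-- truncation -/
def piN (A : Type u) [CommRing A] [IsLocalRing A] (N : ℕ) :
    Completion A →+* A ⧸ maximalIdeal A ^ N :=
  (AdicCompletion.evalₐ (maximalIdeal A) N : Completion A →ₐ[A] A ⧸ maximalIdeal A ^ N).toRingHom

theorem piN_cmpl (N : ℕ) (x : A) : piN A N (cmpl x) = Ideal.Quotient.mk _ x :=
  (AdicCompletion.evalₐ (maximalIdeal A) N).commutes x

theorem mem_of_mk {N : ℕ} {I : Ideal A} {x : A}
    (h : Ideal.Quotient.mk (maximalIdeal A ^ N) x ∈ I.map (Ideal.Quotient.mk _)) :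
    x ∈ I ⊔ maximalIdeal A ^ N := by
  obtain ⟨z, hz, hzx⟩ := (Ideal.mem_map_iff_of_surjective _ Ideal.Quotient.mk_surjective).mp h
  have := Ideal.Quotient.eq.mp hzx.symm
  have h3 : x - z ∈ I ⊔ maximalIdeal A ^ N := Ideal.mem_sup_right this
  have h2 := Ideal.add_mem _ h3 (Ideal.mem_sup_left hz)
  rwa [sub_add_cancel] at h2

variable [IsNoetherianRing A]

theorem maxhat : maximalIdeal (Completion A) = (maximalIdeal A).map (cmpl (R := A)) :=
  AdicCompletion.maximalIdeal_eq_map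

theorem piN_pow {N : ℕ} {x : Completion A} :
    x ∈ maximalIdeal (Completion A) ^ N ↔ piN A N x = 0 := by
  rw [maxhat, ← Ideal.map_pow]
  constructor
  · intro h
    have := Ideal.mem_map_of_mem (piN A N) h
    rw [Ideal.map_map] at this
    have h2 : (piN A N).comp cmpl = Ideal.Quotient.mk (maximalIdeal A ^ N) :=
      RingHom.ext (piN_cmpl N)
    rw [h2, Ideal.map_quotient_self] at this
    simpa using this
  · intro h
    have h1 : x ∈ (AdicCompletion.eval (maximalIdeal A) A N).ker := by
      rw [LinearMap.mem_ker]
      have h0 : maximalIdeal A ^ N ≤ maximalIdeal A ^ N • (⊤ : Ideal A) := by simp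
      rw [← AdicCompletion.factor_evalₐ_eq_eval _ x h0]
      have h3 : AdicCompletion.evalₐ (maximalIdeal A) N x = 0 := h
      rw [h3, map_zero]
    rw [← AdicCompletion.pow_smul_top_eq_ker_eval (maximalIdeal A).fg_of_isNoetherianRing,
      Ideal.smul_top_eq_map] at h1
    exact h1

theorem approx (x : Completion A) (N : ℕ) :
    ∃ r : A, cmpl r - x ∈ maximalIdeal (Completion A) ^ N := by
  obtain ⟨r, hr⟩ := Ideal.Quotient.mk_surjective (piN A N x)
  refine ⟨r, ?_⟩
  rw [piN_pow, map_sub, piN_cmpl, hr, sub_self]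

theorem transfer {N : ℕ} {I : Ideal A} {J : Ideal (Completion A)}
    (hJ : J.map (piN A N) ≤ I.map (Ideal.Quotient.mk _)) {x : A} (hx : cmpl x ∈ J) :
    x ∈ I ⊔ maximalIdeal A ^ N := by
  apply mem_of_mk
  rw [← piN_cmpl]
  exact hJ (Ideal.mem_map_of_mem _ hx)

theorem transfer_map {N : ℕ} {I : Ideal A} {x : A} (hx : cmpl x ∈ I.map (cmpl (R := A))) :
    x ∈ I ⊔ maximalIdeal A ^ N := by
  refine transfer ?_ hx
  rw [Ideal.map_map]
  have h2 : (piN A N).comp cmpl = Ideal.Quotient.mk (maximalIdeal A ^ N) :=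
    RingHom.ext (piN_cmpl N)
  rw [h2]

theorem descend_mem {I : Ideal A} {x : A} (hx : cmpl x ∈ I.map (cmpl (R := A))) : x ∈ I :=
  krull_closed I (fun _ => transfer_map hx)

theorem par_descend {yh : Completion A} {u : Fin d → A} {N : ℕ} (hN : 2 ≤ N)
    (hp : IsPar yh (fun i => cmpl (u i))) {r : A}
    (hr : cmpl r - yh ∈ maximalIdeal (Completion A) ^ N) : IsPar r u := by
  have hpi : piN A N yh = Ideal.Quotient.mk _ r := by
    rw [← piN_cmpl, eq_comm, ← sub_eq_zero, ← map_sub, ← piN_pow]; exact hr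
  have hmap : (maximalIdeal (Completion A)).map (piN A N) =
      (Ideal.span (insert r (Set.range u))).map (Ideal.Quotient.mk (maximalIdeal A ^ N)) := by
    rw [← hp, Ideal.map_span, Ideal.map_span]
    congr 1
    rw [Set.image_insert_eq, Set.image_insert_eq, hpi, ← Set.range_comp, ← Set.range_comp]
    congr 2
  have hle : maximalIdeal A ≤ Ideal.span (insert r (Set.range u)) ⊔ maximalIdeal A ^ N := by
    intro x hx
    refine transfer (J := maximalIdeal (Completion A)) hmap.le ?_
    rw [maxhat]; exact Ideal.mem_map_of_mem _ hx
  have hle2 : Ideal.span (insert r (Set.range u)) ≤ maximalIdeal A := by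
    intro x hx
    have h1 := Ideal.mem_map_of_mem (Ideal.Quotient.mk (maximalIdeal A ^ N)) hx
    rw [← hmap, maxhat, Ideal.map_map] at h1
    have h2 : (piN A N).comp cmpl = Ideal.Quotient.mk (maximalIdeal A ^ N) :=
      RingHom.ext (piN_cmpl N)
    rw [h2] at h1
    refine (sup_le le_rfl (Ideal.pow_le_self (by omega)) : _ ⊔ maximalIdeal A ^ N ≤ _) (mem_of_mk h1)
  apply le_antisymm hle2
  refine Submodule.le_of_le_smul_of_le_jacobson_bot (maximalIdeal A).fg_of_isNoetherianRing
      (IsLocalRing.maximalIdeal_le_jacobson _) (hle.trans (sup_le_sup le_rfl ?_))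
  rw [smul_eq_mul, ← pow_two]
  exact Ideal.pow_le_pow_right hN

theorem coreHat {y : A} {u : Fin d → A} (h : IsRSP A y u) (yh : Completion A)
    (hp : IsPar yh (fun i => cmpl (u i))) : CoreProp yh (fun i => cmpl (u i)) := by
  intro e he
  let N := deg e + 2
  obtain ⟨r, hr⟩ := approx yh N
  have hpr : IsPar r u := par_descend (by omega : 2 ≤ N) hp hr
  have hcr := coreR (rsp_of_isPar h hpr)
  refine hcr e ?_
  have hpi : piN A N yh = Ideal.Quotient.mk _ r := by
    rw [← piN_cmpl, eq_comm, ← sub_eq_zero, ← map_sub, ← piN_pow]; exact hr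
  have h1 : Ideal.Quotient.mk (maximalIdeal A ^ N) (monomial r u e) ∈
      (mI r u {t | ¬ t ≤ e}).map (Ideal.Quotient.mk (maximalIdeal A ^ N)) := by
    have h2 := Ideal.mem_map_of_mem (piN A N) he
    rw [mI_map] at h2 ⊢
    rw [hpi] at h2
    simp only [piN_cmpl] at h2
    convert h2 using 1
    simp [monomial, hpi, piN_cmpl]
  have h3 := mem_of_mk h1
  refine (sup_le le_rfl ?_ : _ ⊔ maximalIdeal A ^ N ≤ _) h3
  refine (pow_le_mI hpr N).trans (mI_mono ?_)
  intro t ht hle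
  have := deg_mono hle
  simp only [Set.mem_setOf_eq] at ht
  omega

theorem ord_facts {u : Fin d → A} {f : A} (hfM : f ∈ maximalIdeal A)
    (hfu : f ∉ Ideal.span (Set.range u)) :
    1 ≤ ordRes f u ∧ f ∈ maximalIdeal A ^ (ordRes f u) ⊔ Ideal.span (Set.range u) ∧
      f ∉ maximalIdeal A ^ (ordRes f u + 1) ⊔ Ideal.span (Set.range u) := by
  have hN : ∃ N, f ∉ Ideal.span (Set.range u) ⊔ maximalIdeal A ^ N := by
    by_contra hcon
    push Not at hcon
    exact hfu (krull_closed _ hcon)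
  obtain ⟨N, hN⟩ := hN
  have hbdd : BddAbove {n : ℕ | f ∈ (maximalIdeal A) ^ n ⊔ Ideal.span (Set.range u)} := by
    refine ⟨N, fun n hn => ?_⟩
    by_contra hcon
    apply hN
    rw [sup_comm]
    have hle : maximalIdeal A ^ n ⊔ Ideal.span (Set.range u) ≤
        maximalIdeal A ^ N ⊔ Ideal.span (Set.range u) :=
      sup_le_sup (Ideal.pow_le_pow_right (not_le.mp hcon).le) le_rfl
    exact hle hn
  have h1 : 1 ∈ {n : ℕ | f ∈ (maximalIdeal A) ^ n ⊔ Ideal.span (Set.range u)} := by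
    simp only [Set.mem_setOf_eq, pow_one]
    exact Ideal.mem_sup_left hfM
  refine ⟨le_csSup hbdd h1, Nat.sSup_mem ⟨1, h1⟩ hbdd, ?_⟩
  intro hcon
  have : ordRes f u + 1 ≤ ordRes f u := le_csSup hbdd hcon
  omega

theorem ord_hat {u : Fin d → A} {f : A} (hfM : f ∈ maximalIdeal A)
    (hfu : f ∉ Ideal.span (Set.range u)) :
    cmpl f ∈ maximalIdeal (Completion A) ^ (ordRes f u) ⊔ Ideal.span (Set.range fun i => cmpl (u i)) ∧
    cmpl f ∉ maximalIdeal (Completion A) ^ (ordRes f u + 1) ⊔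
      Ideal.span (Set.range fun i => cmpl (u i)) := by
  obtain ⟨_, h1, h2⟩ := ord_facts hfM hfu
  have hmap : ∀ n, maximalIdeal (Completion A) ^ n ⊔ Ideal.span (Set.range fun i => cmpl (u i)) =
      (maximalIdeal A ^ n ⊔ Ideal.span (Set.range u)).map (cmpl (R := A)) := by
    intro n
    rw [Ideal.map_sup, Ideal.map_pow, ← maxhat, Ideal.map_span, ← Set.range_comp]
    rfl
  rw [hmap, hmap]
  exact ⟨Ideal.mem_map_of_mem _ h1, fun h => h2 (descend_mem h)⟩

theorem part1_hat {y : A} {u : Fin d → A} (h : IsRSP A y u) {f : A} (hfM : f ∈ maximalIdeal A)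
    (hfu : f ∉ Ideal.span (Set.range u)) (hempty : CharPolyhedron f u = ∅) :
    ∃ yh : Completion A, IsPar yh (fun i => cmpl (u i)) ∧ ∃ g, IsUnit g ∧
      cmpl f = g * yh ^ (ordRes f u) := by
  have hiff : ∀ yh : Completion A, IsRSPhat A yh u ↔ IsPar yh (fun i => cmpl (u i)) := by
    intro yh
    unfold IsRSPhat IsPar
    rw [maxhat]
  have hy : IsPar (cmpl y : Completion A) (fun i => cmpl (u i)) := by
    have := congrArg (Ideal.map (cmpl (R := A))) (isPar_of_rsp h)
    rw [← maxhat, Ideal.map_span, Set.image_insert_eq, ← Set.range_comp] at this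
    exact this
  refine part1 (coreHat h) (ord_facts hfM hfu).1 (ord_hat hfM hfu).1 (ord_hat hfM hfu).2 hy ?_
  intro v
  by_contra hcon
  push Not at hcon
  have : v ∈ CharPolyhedron f u := by
    simp only [CharPolyhedron, Set.mem_iInter]
    intro yh hyh
    exact hcon yh ((hiff yh).mp hyh)
  rw [hempty] at this
  exact this

theorem part3 {z : A} {u : Fin d → A} (h : IsRSP A z u) {f : A}
    (hf : f ∈ Ideal.span {z ^ ordRes f u}) : Delta f z u = ∅ := by
  unfold Delta DeltaOf smallestFSubset
  apply Set.eq_empty_of_subset_empty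
  apply Set.sInter_subset_of_mem
  refine ⟨⟨by simp, by simp, convex_empty, by simp⟩, ?_⟩
  intro x hx
  simp only [Set.mem_iUnion] at hx
  obtain ⟨c, hc, t, ht, htm, _⟩ := hx
  have := CoreProp.of_expansion (coreR h) hf hc ht
  omega

end Compl

section Gring
variable {d : ℕ} {A : Type u} [CommRing A] [IsLocalRing A] [IsNoetherianRing A]

theorem isReduced_of_regularRing {B : Type u} [CommRing B] (h : IsRegularRing B) :
    IsReduced B := by
  apply isReduced_ofLocalizationMaximal
  intro J hJ
  have := isDomain_of_regular (h.2 J)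
  infer_instance

theorem fiber_reduced (h : HasGeomRegularFormalFibers A) (P : Ideal A) [P.IsPrime] :
    IsReduced (ResidueField (Localization.AtPrime P) ⊗[A] Completion A) := by
  have h1 := isReduced_of_regularRing (h P (ResidueField (Localization.AtPrime P)))
  let e := Algebra.TensorProduct.lid (ResidueField (Localization.AtPrime P))
    (ResidueField (Localization.AtPrime P) ⊗[A] Completion A)
  exact isReduced_of_injective e.symm e.symm.injective

theorem radical_hat (h : HasGeomRegularFormalFibers A) (P : Ideal A) [P.IsPrime]
    {x : Completion A} {n : ℕ} (hx : x ^ n ∈ P.map (cmpl (R := A))) :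
    x ∈ P.map (cmpl (R := A)) := by
  have hred := fiber_reduced h P
  let κ := ResidueField (Localization.AtPrime P)
  let ι : Completion A →ₐ[A] κ ⊗[A] Completion A := Algebra.TensorProduct.includeRight
  have hker : ∀ a : A, algebraMap A κ a = 0 ↔ a ∈ P := by
    intro a
    rw [IsScalarTower.algebraMap_apply A (Localization.AtPrime P) κ]
    change residue _ _ = 0 ↔ _
    rw [residue_eq_zero_iff]
    exact IsLocalization.AtPrime.to_map_mem_maximal_iff _ P a
  have h0 : ∀ w ∈ P.map (cmpl (R := A)), ι w = 0 := by
    intro w hw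
    have : P.map (cmpl (R := A)) ≤ RingHom.ker ι.toRingHom := by
      rw [Ideal.map_le_iff_le_comap]
      intro p hp
      change ι (algebraMap A _ p) = 0
      rw [ι.commutes, IsScalarTower.algebraMap_apply A κ, (hker p).mpr hp, map_zero]
    exact this hw
  have h1 : ι x = 0 := by
    have h2 : ι x ^ n = 0 := by rw [← map_pow]; exact h0 _ hx
    exact IsNilpotent.eq_zero ⟨n, h2⟩
  let j : (A ⧸ P) →ₗ[A] κ := Submodule.liftQ P (Algebra.linearMap A κ)
    (fun p hp => (hker p).mpr hp)
  have hj : Function.Injective j := by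
    rw [← LinearMap.ker_eq_bot]
    apply Submodule.ker_liftQ_eq_bot
    intro p hp
    exact (hker p).mp hp
  have hj2 := Module.Flat.rTensor_preserves_injective_linearMap (M := Completion A) j hj
  have h3 : (Ideal.Quotient.mk P 1) ⊗ₜ[A] x = 0 := by
    apply hj2
    rw [map_zero, LinearMap.rTensor_tmul]
    have : j (Ideal.Quotient.mk P 1) = 1 := by
      change Algebra.linearMap A κ 1 = 1
      simp
    rw [this]
    exact h1
  have h4 := congrArg (TensorProduct.quotTensorEquivQuotSMul (Completion A) P) h3
  rw [map_zero, TensorProduct.quotTensorEquivQuotSMul_mk_tmul, one_smul,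
    Submodule.Quotient.mk_eq_zero, Ideal.smul_top_eq_map] at h4
  exact h4

theorem approx_mem {P : Ideal A} {x : Completion A} (hx : x ∈ P.map (cmpl (R := A))) (N : ℕ) :
    ∃ z ∈ P, cmpl z - x ∈ maximalIdeal (Completion A) ^ N := by
  have h1 := Ideal.mem_map_of_mem (piN A N) hx
  have h2 : (piN A N).comp cmpl = Ideal.Quotient.mk (maximalIdeal A ^ N) :=
    RingHom.ext (piN_cmpl N)
  rw [Ideal.map_map, h2] at h1
  obtain ⟨z, hz, hzx⟩ := (Ideal.mem_map_iff_of_surjective _ Ideal.Quotient.mk_surjective).mp h1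
  refine ⟨z, hz, ?_⟩
  rw [piN_pow, map_sub, piN_cmpl, hzx, sub_self]

theorem part2 (hG : HasGeomRegularFormalFibers A) {y : A} {u : Fin d → A} (h : IsRSP A y u)
    {f : A} (hfM : f ∈ maximalIdeal A) (hf0 : f ≠ 0) {m : ℕ} {yh g : Completion A}
    (hp : IsPar yh (fun i => cmpl (u i))) (hg : IsUnit g) (hfg : cmpl f = g * yh ^ m) :
    ∃ z : A, IsPar z u ∧ f ∈ Ideal.span {z ^ m} := by
  have hdom : IsDomain A := isDomain_of_regular ⟨inferInstance, _, _, h⟩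
  obtain ⟨P, hPmin, hPM⟩ := Ideal.exists_minimalPrimes_le
    ((Ideal.span_singleton_le_iff_mem _).mpr hfM)
  have hPp : P.IsPrime := hPmin.1.1
  have hfP : f ∈ P := hPmin.1.2 (Ideal.mem_span_singleton_self f)
  have hyP : yh ∈ P.map (cmpl (R := A)) := by
    apply radical_hat hG P (n := m)
    have := Ideal.mem_map_of_mem (cmpl (R := A)) hfP
    rw [hfg] at this
    exact (Ideal.unit_mul_mem_iff_mem _ hg).mp this
  obtain ⟨z, hzP, hz⟩ := approx_mem hyP 2
  have hzpar : IsPar z u := par_descend le_rfl hp hz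
  have hzr := rsp_of_isPar h hzpar
  have hz0 : z ≠ 0 := by
    have := factP_notMem hzr ∅ 0 (by simp)
    simpa using this
  have hzp : (Ideal.span {z}).IsPrime := by
    have := factP_prime hzr {0}
    simpa using this
  have hzprime : Prime z := (Ideal.span_singleton_prime hz0).mp hzp
  have hht : P.height = 1 := by
    apply le_antisymm (Ideal.height_le_one_of_isPrincipal_of_mem_minimalPrimes _ P hPmin)
    have hpn : P ≠ ⊥ := fun hb => hf0 (by rw [hb] at hfP; simpa using hfP)
    simpa [Order.one_le_iff_ne_zero]
  have hPz : P = Ideal.span {z} := P.eq_span_singleton_of_height_eq_one hht hzP hzprime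
  refine ⟨z, hzpar, descend_mem ?_⟩
  rw [hPz, Ideal.map_span, Set.image_singleton] at hyP
  rw [Ideal.map_span, Set.image_singleton, Ideal.mem_span_singleton, hfg, map_pow]
  exact Dvd.dvd.mul_left (pow_dvd_pow_of_dvd (Ideal.mem_span_singleton.mp hyP) m) g

theorem hatMap {B : Type u} [CommRing B] [IsLocalRing B] (e : A →+* B)
    (he : (maximalIdeal A).map e ≤ maximalIdeal B) :
    ∃ φ : Completion A →+* Completion B, ∀ x, φ (cmpl x) = cmpl (e x) := by
  have hle : ∀ n, maximalIdeal A ^ n ≤ (maximalIdeal B ^ n).comap e := by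
    intro n
    rw [← Ideal.map_le_iff_le_comap, Ideal.map_pow]
    exact Ideal.pow_right_mono he n
  let F : (n : ℕ) → Completion A →+* B ⧸ maximalIdeal B ^ n := fun n =>
    (Ideal.quotientMap _ e (hle n)).comp (piN A n)
  have hF : ∀ n r, F n (cmpl r) = Ideal.Quotient.mk _ (e r) := by
    intro n r
    simp only [F, RingHom.comp_apply, piN_cmpl, Ideal.quotientMap_mk]
  have hF0 : ∀ n x, x ∈ maximalIdeal (Completion A) ^ n → F n x = 0 := by
    intro n x hx
    simp only [F, RingHom.comp_apply, piN_pow.mp hx, map_zero]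
  have hc : ∀ {m n : ℕ} (hmn : m ≤ n),
      (Ideal.Quotient.factorPow (maximalIdeal B) hmn).comp (F n) = F m := by
    intro m n hmn
    ext x
    obtain ⟨r, hr⟩ := approx x n
    have h1 := hF0 n _ hr
    have h2 := hF0 m _ (Ideal.pow_le_pow_right hmn hr)
    rw [map_sub, hF, sub_eq_zero] at h1 h2
    rw [RingHom.comp_apply, ← h1, ← h2]
    rfl
  refine ⟨AdicCompletion.liftRingHom (maximalIdeal B) F hc, fun x => ?_⟩
  apply AdicCompletion.ext_evalₐ
  intro n
  rw [AdicCompletion.evalₐ_liftRingHom, hF]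
  exact ((AdicCompletion.evalₐ (maximalIdeal B) n).commutes (e x)).symm

end Gring

section Final
variable {d : ℕ}

theorem part2_transport {A B : Type u} [CommRing A] [IsLocalRing A] [IsNoetherianRing A]
    [CommRing B] [IsLocalRing B] [IsNoetherianRing B] (e : A ≃+* B)
    (hG : HasGeomRegularFormalFibers B) {y : A} {u : Fin d → A} (h : IsRSP A y u)
    {f : A} (hfM : f ∈ maximalIdeal A) (hf0 : f ≠ 0) {m : ℕ} {yh g : Completion A}
    (hp : IsPar yh (fun i => cmpl (u i))) (hg : IsUnit g) (hfg : cmpl f = g * yh ^ m) :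
    ∃ z : A, IsPar z u ∧ f ∈ Ideal.span {z ^ m} := by
  have hmax : (maximalIdeal A).map (e : A →+* B) = maximalIdeal B := by
    apply IsLocalRing.eq_maximalIdeal
    exact Ideal.map_isMaximal_of_equiv e
  have hmax' : (maximalIdeal B).map (e.symm : B →+* A) = maximalIdeal A := by
    apply IsLocalRing.eq_maximalIdeal
    exact Ideal.map_isMaximal_of_equiv e.symm
  obtain ⟨φ, hφ⟩ := hatMap (e : A →+* B) hmax.le
  have hφ' : φ.comp cmpl = (cmpl (R := B)).comp (e : A →+* B) := RingHom.ext hφ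
  have hy : IsRSP B (e y) (fun i => e (u i)) := by
    refine ⟨?_, ?_⟩
    · have := congrArg (Ideal.map (e : A →+* B)) (isPar_of_rsp h)
      rw [hmax, Ideal.map_span, Set.image_insert_eq, ← Set.range_comp] at this
      rw [Fin.range_cons]
      exact this
    · rw [← ringKrullDim_eq_of_ringEquiv e]; exact h.2
  have hp' : IsPar (φ yh) (fun i => cmpl (e (u i))) := by
    have := congrArg (Ideal.map φ) hp
    rw [maxhat, Ideal.map_map, hφ', ← Ideal.map_map, hmax, ← maxhat, Ideal.map_span,
      Set.image_insert_eq, ← Set.range_comp] at this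
    have h2 : (φ ∘ fun i => cmpl (u i)) = (fun i => cmpl (e (u i))) := by
      funext i; exact hφ _
    rw [h2] at this
    exact this
  have hfg' : cmpl (e f) = φ g * φ yh ^ m := by
    rw [← map_pow, ← map_mul, ← hfg]; exact (hφ f).symm
  have hfM' : e f ∈ maximalIdeal B := by
    rw [← hmax]; exact Ideal.mem_map_of_mem (e : A →+* B) hfM
  obtain ⟨z, hz, hfz⟩ := part2 hG hy hfM' (by simpa using hf0) hp' (hg.map φ) hfg'
  refine ⟨e.symm z, ?_, ?_⟩
  · have := congrArg (Ideal.map (e.symm : B →+* A)) hz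
    rw [hmax', Ideal.map_span, Set.image_insert_eq, ← Set.range_comp] at this
    have h2 : ((e.symm : B →+* A) ∘ fun i => e (u i)) = u := by
      funext i; simp
    rw [h2] at this
    exact this
  · rw [Ideal.mem_span_singleton] at hfz ⊢
    have := map_dvd e.symm hfz
    simpa using this

end Final
/-- **Lemma II.2.** For a regular local G-ring `R` with r.s.p. `(y, u_1, ..., u_d)`
and `f ∈ M`, `f ∉ (u_1, ..., u_d)`: if the characteristic polyhedron is empty, then
there is `z ∈ R` with `(z, u_1, ..., u_d)` a r.s.p. of `R` and `Δ(f; u; z) = ∅`. -/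
theorem empty_characteristic_polyhedron_without_completion
    {d : ℕ} (R : Type u) [CommRing R] [IsLocalRing R]
    (hreg : IsRegularLocalRing R) (hG : IsGRing R)
    (y : R) (u : Fin d → R) (hrsp : IsRSP R y u)
    (f : R) (hfM : f ∈ maximalIdeal R) (hfu : f ∉ Ideal.span (Set.range u))
    (hempty : CharPolyhedron f u = ∅) :
    ∃ z : R, IsRSP R z u ∧ Delta f z u = (∅ : Set (Fin d → ℝ)) := by
  haveI : IsNoetherianRing R := hreg.1
  obtain ⟨yh, hyh, g, hg, hfg⟩ := part1_hat hrsp hfM hfu hempty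
  haveI : IsNoetherianRing (Localization.AtPrime (maximalIdeal R)) :=
    IsLocalization.isNoetherianRing (maximalIdeal R).primeCompl _ inferInstance
  have hunits : ∀ x ∈ (maximalIdeal R).primeCompl, IsUnit x := by
    intro x hx
    by_contra hcon
    exact hx ((mem_maximalIdeal x).mpr hcon)
  let e : R ≃+* Localization.AtPrime (maximalIdeal R) :=
    (IsLocalization.atUnits R (maximalIdeal R).primeCompl hunits).toRingEquiv
  have hf0 : f ≠ 0 := by
    rintro rfl
    exact hfu (Ideal.zero_mem _)
  obtain ⟨z, hz, hfz⟩ := part2_transport e (hG.2 (maximalIdeal R)) hrsp hfM hf0 hyh hg hfg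
  have hzr := rsp_of_isPar hrsp hz
  exact ⟨z, hzr, part3 hzr hfz⟩

end CharPolyhedra
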